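/- arXiv:2110.11277 — 2 statements merged into one kernel-verified Lean document; each statement's English description precedes it below -/
import Mathlib

section
/- Let φ(s, w) := (4πs³)^{−1/2} Σ_{k∈ℤ} (w + 2k) e^{−(w+2k)²/(4s)} for s > 0, w ∈ (0,1). Fix μ ∈ ℝ, D > 0, l > 0, x_0 ∈ (0, l/2); define F(t) := e^{−μ x_0/(2D)} ∫_0^t e^{−μ² s/(4D)} (D/l²) φ(Ds/l², x_0/l) ds + e^{μ(l−x_0)/(2D)} ∫_0^t e^{−μ² s/(4D)} (D/l²) φ(Ds/l², 1 − x_0/l) ds and f_1(t) := e^{μ(l−x_0)/(2D)} e^{−μ² t/(4D)} (D/l²) φ(Dt/l², 1 − x_0/l). Then N ∫_0^∞ (1 − F(t))^{N−1} f_1(t) dt ∼ η (ln N)^{(β−1)/2} N^{1−β} as N → ∞, where β = ((l − x_0)/x_0)² > 1 and η = exp(μ l √β/(2D)) · √(β π^{β−1}) Γ(β) > 0. -/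
open MeasureTheory Filter Set Real
open scoped Topology

/-- `φ(s,w) = (4πs³)^{-1/2} Σ_{k∈ℤ} (w+2k) e^{-(w+2k)²/(4s)}`. -/
noncomputable def phiDens (s w : ℝ) : ℝ :=
  (Real.sqrt (4 * Real.pi * s ^ 3))⁻¹ *
    ∑' k : ℤ, (w + 2 * (k : ℝ)) * Real.exp (-(w + 2 * (k : ℝ)) ^ 2 / (4 * s))

noncomputable def pk (x s : ℝ) : ℝ :=
  (Real.sqrt (4 * Real.pi * s ^ 3))⁻¹ * (x * Real.exp (-x ^ 2 / (4 * s)))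

lemma pk_pos {x s : ℝ} (hx : 0 < x) (hs : 0 < s) : 0 < pk x s := by
  unfold pk; positivity

lemma pk_nonneg {x s : ℝ} (hx : 0 < x) : 0 ≤ pk x s := by
  unfold pk; positivity

lemma pk_neg (x s : ℝ) : pk (-x) s = - pk x s := by
  unfold pk; rw [neg_sq]; ring

lemma pk_abs (x s : ℝ) : |pk x s| = pk |x| s := by
  unfold pk
  rw [abs_mul, abs_mul, abs_of_nonneg (inv_nonneg.2 (Real.sqrt_nonneg _)), sq_abs,
    abs_of_pos (Real.exp_pos _)]

lemma pk_cont (x : ℝ) : ContinuousOn (pk x) (Ioi 0) := by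
  unfold pk
  intro s hs
  have hs : 0 < s := hs
  apply ContinuousAt.continuousWithinAt
  have h1 : √(4 * π * s ^ 3) ≠ 0 := by positivity
  have h2 : 4 * s ≠ 0 := by positivity
  fun_prop (disch := assumption)

lemma hasSum_phi_odd {s : ℝ} (hs : 0 < s) (w : ℝ) :
    HasSum (fun k : ℤ => pk (w + 2 * k) s)
      ((Real.sqrt (4 * π * s ^ 3))⁻¹ * (2 * HurwitzZeta.oddKernel ((w / 2 : ℝ) : UnitAddCircle) (1 / (π * s)))) := by
  have h := HurwitzZeta.hasSum_int_oddKernel (w / 2) (x := 1 / (π * s)) (by positivity)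
  convert! (h.mul_left 2).mul_left ((Real.sqrt (4 * π * s ^ 3))⁻¹) using 2 with k
  have : -π * ((k : ℝ) + w / 2) ^ 2 * (1 / (π * s)) = -(w + 2 * k) ^ 2 / (4 * s) := by
    field_simp; ring
  rw [this]; unfold pk; ring

lemma phi_tsum (s w : ℝ) : phiDens s w = ∑' k : ℤ, pk (w + 2 * k) s := by
  unfold phiDens pk; rw [tsum_mul_left]

lemma hasSum_phi {s : ℝ} (hs : 0 < s) (w : ℝ) :
    HasSum (fun k : ℤ => pk (w + 2 * k) s) (phiDens s w) := by
  rw [phi_tsum]; exact (hasSum_phi_odd hs w).summable.hasSum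

lemma phi_eq_sin {s : ℝ} (hs : 0 < s) (w : ℝ) :
    phiDens s w = π * HurwitzZeta.sinKernel ((w / 2 : ℝ) : UnitAddCircle) (π * s) := by
  rw [(hasSum_phi hs w).unique (hasSum_phi_odd hs w), HurwitzZeta.oddKernel_functional_equation]
  rw [one_div_one_div, one_div, one_div, Real.inv_rpow (by positivity), inv_inv]
  have h1 : √(4 * π * s ^ 3) = 2 * √π * s ^ (3 / 2 : ℝ) := by
    rw [Real.sqrt_mul (by positivity), Real.sqrt_mul (by positivity)]
    have : √(4 : ℝ) = 2 := by
      rw [show (4 : ℝ) = 2 ^ 2 by norm_num]; exact Real.sqrt_sq (by norm_num)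
    rw [this, Real.sqrt_eq_rpow (s ^ 3), ← Real.rpow_natCast s 3, ← Real.rpow_mul hs.le]
    norm_num
  have h2 : (π * s) ^ (3 / 2 : ℝ) = π * √π * s ^ (3 / 2 : ℝ) := by
    rw [Real.mul_rpow pi_pos.le hs.le, show (3 / 2 : ℝ) = 1 + 1 / 2 by norm_num,
      Real.rpow_add pi_pos, Real.rpow_one, Real.sqrt_eq_rpow]
  rw [h1, h2]
  have : 0 < s ^ (3 / 2 : ℝ) := by positivity
  have : 0 < √π := by positivity
  field_simp

lemma pk_tendsto_zero {w : ℝ} (hw : 0 < w) : Tendsto (pk w) (𝓝[>] 0) (𝓝 0) := by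
  have h := (tendsto_rpow_mul_exp_neg_mul_atTop_nhds_zero (3 / 2) (w ^ 2 / 4) (by positivity)).comp
    tendsto_inv_nhdsGT_zero
  have h := h.const_mul ((√(4 * π))⁻¹ * w)
  rw [mul_zero] at h
  refine h.congr' ?_
  filter_upwards [self_mem_nhdsWithin] with s hs
  have hs : 0 < s := hs
  simp only [Function.comp]
  unfold pk
  rw [Real.sqrt_mul (x := 4 * π) (by positivity) (s ^ 3), Real.sqrt_eq_rpow (s ^ 3),
    ← Real.rpow_natCast s 3, ← Real.rpow_mul hs.le, Real.inv_rpow hs.le,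
    show -(w ^ 2 / 4) * s⁻¹ = -w ^ 2 / (4 * s) by field_simp]
  norm_num
  ring

lemma phi_asymp {w : ℝ} (hw : 0 < w) (hw1 : w < 1) :
    Tendsto (fun s => phiDens s w / pk w s) (𝓝[>] 0) (𝓝 1) := by
  have hterm : ∀ s : ℝ, 0 < s → ∀ k : ℤ, pk (w + 2 * k) s / pk w s
      = (w + 2 * k) / w * Real.exp (-(k * (k + w) / s)) := by
    intro s hs k
    unfold pk
    have h1 : 0 < √(4 * π * s ^ 3) := by positivity
    have : Real.exp (-(w + 2 * k) ^ 2 / (4 * s)) =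
        Real.exp (-w ^ 2 / (4 * s)) * Real.exp (-(k * (k + w) / s)) := by
      rw [← Real.exp_add]; congr 1; field_simp; ring
    rw [this]
    have h2 := Real.exp_pos (-w ^ 2 / (4 * s))
    field_simp
  have hkpos : ∀ k : ℤ, k ≠ 0 → 0 < (k : ℝ) * (k + w) := by
    intro k hk
    rcases lt_or_gt_of_ne hk with h | h
    · have : (k : ℝ) ≤ -1 := by exact_mod_cast (by omega : k ≤ -1)
      nlinarith
    · have : (1 : ℝ) ≤ k := by exact_mod_cast h
      nlinarith
  have key : Tendsto (fun s => ∑' k : ℤ, (w + 2 * k) / w * Real.exp (-(k * (k + w) / s)))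
      (𝓝[>] 0) (𝓝 (∑' k : ℤ, if k = 0 then (1 : ℝ) else 0)) := by
    refine tendsto_tsum_of_dominated_convergence
      (bound := fun k : ℤ => |pk (w + 2 * k) 1 / pk w 1|) ?_ ?_ ?_
    · exact ((hasSum_phi one_pos w).summable.div_const _).abs
    · intro k
      split_ifs with hk
      · subst hk
        simp only [Int.cast_zero, mul_zero, add_zero, zero_mul, zero_div, neg_zero, Real.exp_zero,
          mul_one, div_self hw.ne']
        exact tendsto_const_nhds
      · have hz : (0 : ℝ) = (w + 2 * k) / w * 0 := by ring
        suffices Tendsto (fun s : ℝ => Real.exp (-(k * (k + w) / s))) (𝓝[>] 0) (𝓝 0) by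
          have h3 := this.const_mul ((w + 2 * k) / w)
          rwa [← hz] at h3
        have h4 : Tendsto (fun s : ℝ => (k : ℝ) * (k + w) / s) (𝓝[>] 0) atTop := by
          simp_rw [div_eq_mul_inv]
          exact Tendsto.const_mul_atTop (hkpos k hk) tendsto_inv_nhdsGT_zero
        exact Real.tendsto_exp_neg_atTop_nhds_zero.comp h4
    · filter_upwards [Ioo_mem_nhdsGT (zero_lt_one' ℝ)] with s hs k
      rw [hterm 1 one_pos, Real.norm_eq_abs, abs_mul, abs_mul, abs_of_pos (Real.exp_pos _),
        abs_of_pos (Real.exp_pos _)]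
      gcongr ?_ * Real.exp ?_
      · rw [neg_le_neg_iff]
        have h0 : 0 ≤ (k : ℝ) * (k + w) := by
          by_cases hk : k = 0
          · simp [hk]
          · exact (hkpos k hk).le
        exact div_le_div_of_nonneg_left h0 hs.1 hs.2.le
  rw [tsum_ite_eq] at key
  refine key.congr' ?_
  filter_upwards [self_mem_nhdsWithin] with s hs
  rw [phi_tsum, ← tsum_div_const]
  exact tsum_congr fun k => (hterm s hs k).symm

lemma phi_zero (w : ℝ) : phiDens 0 w = 0 := by
  unfold phiDens; simp

lemma phi_tendsto_zero {w : ℝ} (hw : 0 < w) (hw1 : w < 1) :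
    Tendsto (fun s => phiDens s w) (𝓝[>] 0) (𝓝 0) := by
  have h := (phi_asymp hw hw1).mul (pk_tendsto_zero hw)
  rw [mul_zero] at h
  refine h.congr' ?_
  filter_upwards [self_mem_nhdsWithin] with s hs
  exact div_mul_cancel₀ _ (pk_pos hw hs).ne'

lemma phi_contAt (w : ℝ) {s : ℝ} (hs : 0 < s) : ContinuousAt (fun s => phiDens s w) s := by
  have h1 : ContinuousAt (fun s => π * HurwitzZeta.sinKernel ((w / 2 : ℝ) : UnitAddCircle) (π * s)) s := by
    have := (HurwitzZeta.continuousOn_sinKernel ((w / 2 : ℝ) : UnitAddCircle)).continuousAt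
      (Ioi_mem_nhds (show 0 < π * s by positivity))
    refine ContinuousAt.mul continuousAt_const ?_
    exact ContinuousAt.comp (f := fun s => π * s) this (by fun_prop)
  refine h1.congr ?_
  filter_upwards [Ioi_mem_nhds hs] with r hr
  exact (phi_eq_sin hr w).symm

lemma phi_cont {w : ℝ} (hw : 0 < w) (hw1 : w < 1) : ContinuousOn (fun s => phiDens s w) (Ici 0) := by
  intro s hs
  rcases eq_or_lt_of_le (show 0 ≤ s from hs) with h | h
  · subst h
    rw [← continuousWithinAt_Ioi_iff_Ici]
    unfold ContinuousWithinAt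
    simp only [phi_zero]
    exact phi_tendsto_zero hw hw1
  · exact (phi_contAt w h).continuousWithinAt

lemma phi_integrable {w : ℝ} (hw : 0 < w) (hw1 : w < 1) :
    IntegrableOn (fun s => phiDens s w) (Ioi 0) := by
  obtain ⟨p, hp, hO⟩ := HurwitzZeta.isBigO_atTop_sinKernel ((w / 2 : ℝ) : UnitAddCircle)
  refine integrable_of_isBigO_exp_neg (b := p * π) (by positivity) (phi_cont hw hw1) ?_
  have h1 : Tendsto (fun s : ℝ => π * s) atTop atTop := tendsto_id.const_mul_atTop pi_pos
  have h2 := (hO.comp_tendsto h1).const_mul_left π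
  refine (h2.congr' ?_ ?_)
  · filter_upwards [eventually_gt_atTop 0] with s hs
    exact (phi_eq_sin hs w).symm
  · filter_upwards with s
    simp only [Function.comp]
    congr 1; ring

noncomputable def gS (z : ℝ) : ℝ := (√π)⁻¹ * ∫ y in Iic z, Real.exp (-y ^ 2)

lemma gauss_int : Integrable (fun y : ℝ => Real.exp (-y ^ 2)) := by
  simpa using integrable_exp_neg_mul_sq (b := 1) one_pos

lemma gauss_total : ∫ y : ℝ, Real.exp (-y ^ 2) = √π := by
  simpa using integral_gaussian 1

lemma gS_deriv (z : ℝ) : HasDerivAt gS ((√π)⁻¹ * Real.exp (-z ^ 2)) z := by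
  unfold gS
  refine HasDerivAt.const_mul _ ?_
  have h : (fun z => ∫ y in Iic z, Real.exp (-y ^ 2)) =
      fun z => (∫ y in (0 : ℝ)..z, Real.exp (-y ^ 2)) + ∫ y in Iic (0 : ℝ), Real.exp (-y ^ 2) := by
    ext z
    rw [← intervalIntegral.integral_Iic_sub_Iic gauss_int.integrableOn gauss_int.integrableOn]
    ring
  rw [h]
  refine HasDerivAt.add_const _ ?_
  exact (by fun_prop : Continuous fun y : ℝ => Real.exp (-y ^ 2)).integral_hasStrictDerivAt 0 z
    |>.hasDerivAt

lemma gS_top : Tendsto gS atTop (𝓝 1) := by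
  have h := (aecover_Iic (μ := (volume : Measure ℝ)) tendsto_id).integral_tendsto_of_countably_generated gauss_int
  have h := h.const_mul (√π)⁻¹
  rw [gauss_total, inv_mul_cancel₀ (by positivity)] at h
  exact h

lemma gS_bot : Tendsto gS atBot (𝓝 0) := by
  have h := (aecover_Ioi (μ := (volume : Measure ℝ)) tendsto_id).integral_tendsto_of_countably_generated gauss_int
  have h := (h.const_sub (√π)).const_mul (√π)⁻¹
  rw [gauss_total, sub_self, mul_zero] at h
  refine h.congr fun z => ?_
  unfold gS
  rw [← gauss_total, ← intervalIntegral.integral_Iic_add_Ioi (b := z) gauss_int.integrableOn gauss_int.integrableOn]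
  simp

noncomputable def Psi (c x s : ℝ) : ℝ :=
  if s ≤ 0 then 0 else Real.exp (-c * x) * gS (c * √s - x / (2 * √s))
    + Real.exp (c * x) * gS (-(c * √s) - x / (2 * √s))

lemma Psi_deriv (c x : ℝ) {s : ℝ} (hs : 0 < s) :
    HasDerivAt (Psi c x) (Real.exp (-c ^ 2 * s) * pk x s) s := by
  have hr : 0 < √s := Real.sqrt_pos.2 hs
  have hsr : s = √s ^ 2 := (Real.sq_sqrt hs.le).symm
  have h1 := (Real.hasDerivAt_sqrt hs.ne').const_mul c
  have h2 := ((Real.hasDerivAt_sqrt hs.ne').const_mul 2).inv (by positivity) |>.const_mul x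
  have hA := (((gS_deriv _).comp s (h1.sub h2)).const_mul (Real.exp (-c * x))).add
    (((gS_deriv _).comp s (h1.neg.sub h2)).const_mul (Real.exp (c * x)))
  have hB := hA.congr_of_eventuallyEq (f₁ := Psi c x) ?_
  · refine hB.congr_deriv ?_
    simp only [Pi.sub_apply, Pi.neg_apply, Pi.inv_apply]
    have e1 : Real.exp (-(c * √s - x * (2 * √s)⁻¹) ^ 2) =
        Real.exp (c * x) * (Real.exp (-c ^ 2 * s) * Real.exp (-x ^ 2 / (4 * s))) := by
      rw [← Real.exp_add, ← Real.exp_add]; congr 1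
      generalize √s = r at *
      subst hsr; field_simp; ring
    have e2 : Real.exp (-(-(c * √s) - x * (2 * √s)⁻¹) ^ 2) =
        Real.exp (-c * x) * (Real.exp (-c ^ 2 * s) * Real.exp (-x ^ 2 / (4 * s))) := by
      rw [← Real.exp_add, ← Real.exp_add]; congr 1
      generalize √s = r at *
      subst hsr; field_simp; ring
    have e3 : √(4 * π * s ^ 3) = 2 * √π * √s ^ 3 := by
      rw [show 4 * π * s ^ 3 = π * (2 * √s ^ 3) ^ 2 by
        generalize √s = r at *
        subst hsr; ring]
      rw [Real.sqrt_mul pi_pos.le, Real.sqrt_sq (by positivity)]; ring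
    have e4 : Real.exp (-c * x) * Real.exp (c * x) = 1 := by
      rw [← Real.exp_add]; simp
    rw [e1, e2]; unfold pk; rw [e3]
    have hpi : 0 < √π := by positivity
    generalize Real.exp (-c * x) = u at *
    generalize Real.exp (c * x) = v at *
    generalize Real.exp (-c ^ 2 * s) = p at *
    generalize Real.exp (-x ^ 2 / (4 * s)) = q at *
    generalize √s = r at *
    generalize √π = k at *
    field_simp
    linear_combination (p * q * (2 * x)) * e4
  · filter_upwards [Ioi_mem_nhds hs] with t ht
    simp [Psi, not_le.2 (show 0 < t from ht), div_eq_mul_inv]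

lemma Psi_cont0 {c x : ℝ} (hx : 0 < x) (hc : 0 ≤ c) : ContinuousWithinAt (Psi c x) (Ici 0) 0 := by
  rw [← continuousWithinAt_Ioi_iff_Ici]
  unfold ContinuousWithinAt
  have h0 : Psi c x 0 = 0 := by simp [Psi]
  rw [h0]
  have hs0 : Tendsto (fun s : ℝ => √s) (𝓝[>] 0) (𝓝 0) := by
    have := (Real.continuous_sqrt.tendsto 0).mono_left (nhdsWithin_le_nhds (s := Ioi 0))
    simpa using this
  have hs1 : Tendsto (fun s : ℝ => x / (2 * √s)) (𝓝[>] 0) atTop := by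
    have h : Tendsto (fun s : ℝ => √s) (𝓝[>] 0) (𝓝[>] 0) := by
      refine tendsto_nhdsWithin_iff.2 ⟨hs0, ?_⟩
      filter_upwards [self_mem_nhdsWithin] with s hs
      exact Real.sqrt_pos.2 hs
    have h := (tendsto_inv_nhdsGT_zero.comp h).const_mul_atTop (show 0 < x / 2 by positivity)
    refine h.congr fun s => ?_
    simp only [Function.comp]; field_simp
  have g : ∀ d : ℝ, Tendsto (fun s : ℝ => d * √s - x / (2 * √s)) (𝓝[>] 0) atBot := by
    intro d
    have h1 := hs0.const_mul d
    have := h1.add_atBot (tendsto_neg_atTop_atBot.comp hs1)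
    exact this
  have h1 := ((gS_bot.comp (g c)).const_mul (Real.exp (-c * x))).add
    ((gS_bot.comp (g (-c))).const_mul (Real.exp (c * x)))
  simp only [mul_zero, add_zero] at h1
  refine h1.congr' ?_
  filter_upwards [self_mem_nhdsWithin] with t ht
  simp [Psi, not_le.2 (show 0 < t from ht)]

lemma Psi_top {c x : ℝ} (hc : 0 < c) : Tendsto (Psi c x) atTop (𝓝 (Real.exp (-c * x))) := by
  have hs1 : Tendsto (fun s : ℝ => x / (2 * √s)) atTop (𝓝 0) := by
    have h := (tendsto_inv_atTop_zero.comp Real.tendsto_sqrt_atTop).const_mul (x / 2)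
    rw [mul_zero] at h
    refine h.congr fun s => ?_
    simp only [Function.comp]; ring
  have h2 : Tendsto (fun s : ℝ => c * √s) atTop atTop := Real.tendsto_sqrt_atTop.const_mul_atTop hc
  have g1 : Tendsto (fun s : ℝ => c * √s - x / (2 * √s)) atTop atTop := by
    simp_rw [sub_eq_add_neg]
    exact h2.atTop_add hs1.neg
  have g2 : Tendsto (fun s : ℝ => -(c * √s) - x / (2 * √s)) atTop atBot := by
    simp_rw [sub_eq_add_neg]
    exact (tendsto_neg_atTop_atBot.comp h2).atBot_add hs1.neg
  have h1 := ((gS_top.comp g1).const_mul (Real.exp (-c * x))).add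
    ((gS_bot.comp g2).const_mul (Real.exp (c * x)))
  simp only [mul_zero, add_zero, mul_one] at h1
  refine h1.congr' ?_
  filter_upwards [eventually_gt_atTop 0] with t ht
  simp [Psi, not_le.2 ht]

lemma laplace_int {c x : ℝ} (hc : 0 < c) (hx : 0 < x) :
    IntegrableOn (fun s => Real.exp (-c ^ 2 * s) * pk x s) (Ioi 0) :=
  integrableOn_Ioi_deriv_of_nonneg (Psi_cont0 hx hc.le) (fun _ hs => Psi_deriv c x hs)
    (fun s _ => mul_nonneg (Real.exp_pos _).le (pk_nonneg hx)) (Psi_top hc)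

lemma laplace_eq {c x : ℝ} (hc : 0 < c) (hx : 0 < x) :
    ∫ s in Ioi 0, Real.exp (-c ^ 2 * s) * pk x s = Real.exp (-c * x) := by
  rw [integral_Ioi_of_hasDerivAt_of_nonneg (Psi_cont0 hx hc.le) (fun _ hs => Psi_deriv c x hs)
    (fun s _ => mul_nonneg (Real.exp_pos _).le (pk_nonneg hx)) (Psi_top hc)]
  simp [Psi]

noncomputable def Pt (c x t : ℝ) : ℝ := ∫ s in Ioc 0 t, Real.exp (-c ^ 2 * s) * pk x s

lemma pk_cont0 {x : ℝ} (hx : 0 < x) : ContinuousOn (pk x) (Ici 0) := by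
  intro s hs
  rcases eq_or_lt_of_le (show 0 ≤ s from hs) with h | h
  · subst h
    rw [← continuousWithinAt_Ioi_iff_Ici]
    unfold ContinuousWithinAt
    have : pk x 0 = 0 := by simp [pk]
    rw [this]
    exact pk_tendsto_zero hx
  · exact ((pk_cont x).continuousAt (Ioi_mem_nhds h)).continuousWithinAt

lemma epk_cont {c x : ℝ} (hx : 0 < x) :
    ContinuousOn (fun s => Real.exp (-c ^ 2 * s) * pk x s) (Ici 0) :=
  ContinuousOn.mul (by fun_prop) (pk_cont0 hx)

lemma epk_int {c x t : ℝ} (hx : 0 < x) :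
    IntegrableOn (fun s => Real.exp (-c ^ 2 * s) * pk x s) (Ioc 0 t) :=
  (((epk_cont hx).mono Icc_subset_Ici_self).integrableOn_Icc).mono_set Ioc_subset_Icc_self

lemma Pt_le {c x t d : ℝ} (hx : 0 < x) (hd : 0 < d) :
    Pt c x t ≤ Real.exp (d ^ 2 * t) * Real.exp (-d * x) := by
  unfold Pt
  calc ∫ s in Ioc 0 t, Real.exp (-c ^ 2 * s) * pk x s
      ≤ ∫ s in Ioc 0 t, Real.exp (d ^ 2 * t) * (Real.exp (-d ^ 2 * s) * pk x s) := by
        refine setIntegral_mono_on (epk_int hx) ((epk_int hx).const_mul _) measurableSet_Ioc ?_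
        intro s hs
        rw [← mul_assoc, ← Real.exp_add]
        refine mul_le_mul_of_nonneg_right (Real.exp_le_exp.2 ?_) (pk_nonneg hx)
        have h1 : 0 ≤ c ^ 2 * s := mul_nonneg (sq_nonneg _) hs.1.le
        have h2 : d ^ 2 * s ≤ d ^ 2 * t := mul_le_mul_of_nonneg_left hs.2 (sq_nonneg _)
        linarith
    _ = Real.exp (d ^ 2 * t) * ∫ s in Ioc 0 t, (Real.exp (-d ^ 2 * s) * pk x s) :=
        integral_const_mul _ _
    _ ≤ _ := by
        gcongr
        rw [← laplace_eq hd hx]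
        refine setIntegral_mono_set (laplace_int hd hx) ?_ ?_
        · filter_upwards with s
          exact mul_nonneg (Real.exp_pos _).le (pk_nonneg hx)
        · exact (Ioc_subset_Ioi_self).eventuallyLE

lemma Pt_le' {c x t : ℝ} (hx : 0 < x) (hc : 0 < c) : Pt c x t ≤ Real.exp (-c * x) := by
  unfold Pt
  rw [← laplace_eq hc hx]
  refine setIntegral_mono_set (laplace_int hc hx) ?_ ?_
  · filter_upwards with s
    exact mul_nonneg (Real.exp_pos _).le (pk_nonneg hx)
  · exact (Ioc_subset_Ioi_self).eventuallyLE

lemma Pt_scale {c x t : ℝ} (hx : 0 < x) (ht : 0 < t) :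
    Pt c x t = ∫ r in (0 : ℝ)..(t / x ^ 2), Real.exp (-(c * x) ^ 2 * r) * pk 1 r := by
  have h := intervalIntegral.mul_integral_comp_mul_left (a := 0) (b := t / x ^ 2)
    (f := fun s => Real.exp (-c ^ 2 * s) * pk x s) (x ^ 2)
  rw [mul_zero, mul_div_cancel₀ _ (by positivity)] at h
  unfold Pt
  rw [← intervalIntegral.integral_of_le ht.le, ← h, ← intervalIntegral.integral_const_mul]
  refine intervalIntegral.integral_congr fun r hr => ?_
  rw [uIcc_of_le (by positivity)] at hr
  have hr0 : 0 ≤ r := hr.1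
  have e1 : √(4 * π * (x ^ 2 * r) ^ 3) = x ^ 3 * √(4 * π * r ^ 3) := by
    rw [show 4 * π * (x ^ 2 * r) ^ 3 = (x ^ 3) ^ 2 * (4 * π * r ^ 3) by ring,
      Real.sqrt_mul (by positivity), Real.sqrt_sq (by positivity)]
  have e2 : -x ^ 2 / (4 * (x ^ 2 * r)) = -1 ^ 2 / (4 * r) := by
    rcases eq_or_lt_of_le hr0 with h | h
    · subst h; simp
    · field_simp
  have e3 : -c ^ 2 * (x ^ 2 * r) = -(c * x) ^ 2 * r := by ring
  unfold pk
  simp only [e1, e2, e3]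
  field_simp

lemma Pt_strict {c x y t : ℝ} (hx : 0 < x) (hxy : x < y) (ht : 0 < t) : Pt c y t < Pt c x t := by
  have hy := hx.trans hxy
  rw [Pt_scale hx ht, Pt_scale hy ht]
  have hle : t / y ^ 2 < t / x ^ 2 := by gcongr
  have hii : ∀ d a b : ℝ, 0 ≤ a → a ≤ b → IntervalIntegrable (fun r => Real.exp (-d ^ 2 * r) * pk 1 r) volume a b := by
    intro d a b ha hab
    refine ContinuousOn.intervalIntegrable ?_
    rw [uIcc_of_le hab]
    exact (epk_cont one_pos).mono fun r hr => ha.trans hr.1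
  have h0 : 0 < t / y ^ 2 := by positivity
  have h1 : ∫ r in (0 : ℝ)..(t / y ^ 2), Real.exp (-(c * y) ^ 2 * r) * pk 1 r ≤
      ∫ r in (0 : ℝ)..(t / y ^ 2), Real.exp (-(c * x) ^ 2 * r) * pk 1 r := by
    refine intervalIntegral.integral_mono_on h0.le (hii _ _ _ le_rfl h0.le) (hii _ _ _ le_rfl h0.le) ?_
    intro r hr
    refine mul_le_mul_of_nonneg_right (Real.exp_le_exp.2 ?_) (pk_nonneg one_pos)
    have : (c * x) ^ 2 ≤ (c * y) ^ 2 := by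
      rw [mul_pow, mul_pow]; gcongr
    have := mul_le_mul_of_nonneg_right this hr.1
    linarith
  refine h1.trans_lt ?_
  rw [← intervalIntegral.integral_add_adjacent_intervals (hii _ _ _ le_rfl h0.le) (hii _ _ _ h0.le hle.le)]
  have := intervalIntegral.intervalIntegral_pos_of_pos_on (hii (c * x) _ _ h0.le hle.le)
    (fun r hr => mul_pos (Real.exp_pos _) (pk_pos one_pos (h0.trans hr.1))) hle
  linarith

lemma Pt_nonneg {c x t : ℝ} (hx : 0 < x) : 0 ≤ Pt c x t :=
  integral_nonneg fun s => mul_nonneg (Real.exp_pos _).le (pk_nonneg hx)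

lemma summ_aux {d w : ℝ} (hd : 0 < d) (hw : 0 < w) (hw1 : w < 1) :
    Summable (fun k : ℤ => Real.exp (-d * |w + 2 * k|)) := by
  have hb : ∀ k : ℤ, Real.exp (-d * |w + 2 * k|) ≤ Real.exp d * Real.exp (-(2 * d)) ^ k.natAbs := by
    intro k
    rw [← Real.exp_nat_mul, ← Real.exp_add]
    apply Real.exp_le_exp.2
    rw [Nat.cast_natAbs, Int.cast_abs]
    have : 2 * |(k : ℝ)| ≤ |w + 2 * k| + 1 := by
      have h1 : |2 * (k : ℝ)| = |(w + 2 * k) - w| := by ring_nf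
      have h2 := abs_sub (w + 2 * (k : ℝ)) w
      rw [abs_mul, abs_two] at h1
      rw [abs_of_pos hw] at h2
      linarith
    nlinarith
  have hg : Summable (fun n : ℕ => Real.exp d * Real.exp (-(2 * d)) ^ n) :=
    (summable_geometric_of_lt_one (Real.exp_pos _).le (by
      rw [Real.exp_lt_one_iff]; linarith)).mul_left _
  refine Summable.of_nonneg_of_le (fun k => (Real.exp_pos _).le) hb ?_
  refine Summable.of_nat_of_neg ?_ ?_
  · simpa using hg
  · simpa using hg

lemma series_aux {S : Set ℝ} (hSm : MeasurableSet S) (hS : S ⊆ Ioi 0) {c w C d : ℝ} (hd : 0 < d)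
    (hw : 0 < w) (hw1 : w < 1)
    (hint : ∀ x, 0 < x → IntegrableOn (fun s => Real.exp (-c ^ 2 * s) * pk x s) S)
    (hbd : ∀ x, 0 < x → ∫ s in S, Real.exp (-c ^ 2 * s) * pk x s ≤ C * Real.exp (-d * x)) :
    HasSum (fun n : ℕ => (∫ s in S, Real.exp (-c ^ 2 * s) * pk (w + 2 * n) s) -
      ∫ s in S, Real.exp (-c ^ 2 * s) * pk (2 * n + 2 - w) s)
      (∫ s in S, Real.exp (-c ^ 2 * s) * phiDens s w) := by
  have hne : ∀ k : ℤ, w + 2 * (k : ℝ) ≠ 0 := by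
    intro k hk
    rcases le_or_gt 0 k with h | h
    · have : (0 : ℝ) ≤ k := by exact_mod_cast h
      linarith
    · have : (k : ℝ) ≤ -1 := by exact_mod_cast (by omega : k ≤ -1)
      linarith
  have hnorm : ∀ k : ℤ, ∀ s : ℝ, ‖Real.exp (-c ^ 2 * s) * pk (w + 2 * k) s‖ =
      Real.exp (-c ^ 2 * s) * pk |w + 2 * k| s := by
    intro k s
    rw [norm_mul, Real.norm_eq_abs, Real.norm_eq_abs, pk_abs, abs_of_pos (Real.exp_pos _)]
  have hI : ∀ k : ℤ, IntegrableOn (fun s => Real.exp (-c ^ 2 * s) * pk (w + 2 * k) s) S := by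
    intro k
    rcases lt_or_gt_of_ne (hne k) with h | h
    · have := (hint _ (neg_pos.2 h)).neg
      refine this.congr ?_
      filter_upwards with s
      rw [Pi.neg_apply, pk_neg, mul_neg, neg_neg]
    · exact hint _ h
  have h1 := hasSum_integral_of_summable_integral_norm (μ := volume.restrict S)
    (F := fun (k : ℤ) s => Real.exp (-c ^ 2 * s) * pk (w + 2 * k) s) hI (by
      simp_rw [hnorm]
      refine Summable.of_nonneg_of_le (fun k => ?_) (fun k => hbd _ (abs_pos.2 (hne k)))
        ((summ_aux hd hw hw1).mul_left C)
      exact integral_nonneg fun s => mul_nonneg (Real.exp_pos _).le (pk_nonneg (abs_pos.2 (hne k))))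
  have h2 : ∫ s in S, ∑' k : ℤ, Real.exp (-c ^ 2 * s) * pk (w + 2 * k) s =
      ∫ s in S, Real.exp (-c ^ 2 * s) * phiDens s w := by
    refine setIntegral_congr_fun hSm fun s hs => ?_
    rw [tsum_mul_left, phi_tsum]
  rw [h2] at h1
  refine h1.nat_add_neg_add_one.congr_fun fun n => ?_
  rw [sub_eq_add_neg, ← integral_neg]
  congr 2
  ext s
  rw [← mul_neg, ← pk_neg]
  congr 2
  push_cast; ring

noncomputable def Gt (c w t : ℝ) : ℝ := ∫ s in Ioc 0 t, Real.exp (-c ^ 2 * s) * phiDens s w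

lemma Gt_hasSum {c w t : ℝ} (hw : 0 < w) (hw1 : w < 1) :
    HasSum (fun n : ℕ => Pt c (w + 2 * n) t - Pt c (2 * n + 2 - w) t) (Gt c w t) :=
  series_aux measurableSet_Ioc Ioc_subset_Ioi_self one_pos hw hw1 (fun _ hx => epk_int hx)
    (fun _ hx => Pt_le (d := 1) hx one_pos)

lemma Gt_pos {c w t : ℝ} (hw : 0 < w) (hw1 : w < 1) (ht : 0 < t) : 0 < Gt c w t := by
  have h := le_hasSum (Gt_hasSum (c := c) (t := t) hw hw1) 0 (fun n _ => by
    have hn : (0 : ℝ) ≤ n := Nat.cast_nonneg n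
    exact sub_nonneg.2 (Pt_strict (by positivity) (by linarith) ht).le)
  refine lt_of_lt_of_le ?_ h
  simp only [Nat.cast_zero]
  exact sub_pos.2 (Pt_strict (by linarith) (by linarith) ht)

lemma Gt_le {c w t : ℝ} (hw : 0 < w) (hw1 : w < 1) (ht : 0 < t) : Gt c w t ≤ Pt c w t := by
  refine le_of_tendsto (Gt_hasSum (c := c) (t := t) hw hw1).tendsto_sum_nat ?_
  filter_upwards with M
  calc ∑ n ∈ Finset.range M, (Pt c (w + 2 * n) t - Pt c (2 * n + 2 - w) t)
      ≤ ∑ n ∈ Finset.range M, (Pt c (w + 2 * n) t - Pt c (w + 2 * ((n + 1 : ℕ) : ℝ)) t) := by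
        refine Finset.sum_le_sum fun n _ => ?_
        have hn : (0 : ℝ) ≤ n := Nat.cast_nonneg n
        refine sub_le_sub_left (Pt_strict (by linarith) ?_ ht).le _
        push_cast; linarith
    _ = Pt c (w + 2 * ((0 : ℕ) : ℝ)) t - Pt c (w + 2 * M) t :=
        Finset.sum_range_sub' (fun n : ℕ => Pt c (w + 2 * n) t) M
    _ ≤ Pt c w t := by
        have := Pt_nonneg (c := c) (t := t) (x := w + 2 * M) (by positivity)
        simp; linarith

noncomputable def Linf (c w : ℝ) : ℝ := ∫ s in Ioi 0, Real.exp (-c ^ 2 * s) * phiDens s w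

lemma Linf_eq {c w : ℝ} (hw : 0 < w) (hw1 : w < 1) (hc : 0 < c) :
    Linf c w * (1 - Real.exp (-(2 * c))) = Real.exp (-c * w) - Real.exp (-c * (2 - w)) := by
  have h := series_aux (S := Ioi 0) (c := c) (C := 1) measurableSet_Ioi subset_rfl hc hw hw1
    (fun _ hx => laplace_int hc hx) (fun _ hx => by rw [laplace_eq hc hx]; simp)
  have hlt : Real.exp (-(2 * c)) < 1 := by rw [Real.exp_lt_one_iff]; linarith
  have h2 := (hasSum_geometric_of_lt_one (Real.exp_pos _).le hlt).mul_left
    (Real.exp (-c * w) - Real.exp (-c * (2 - w)))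
  have h3 := h.unique (h2.congr_fun fun n => by
    have hn : (0 : ℝ) ≤ n := Nat.cast_nonneg n
    rw [laplace_eq hc (by positivity), laplace_eq hc (by linarith), ← Real.exp_nat_mul, sub_mul,
      ← Real.exp_add, ← Real.exp_add]
    ring_nf)
  unfold Linf
  rw [h3, mul_assoc, inv_mul_cancel₀ (by linarith), mul_one]

lemma Linf_total_pos {c w : ℝ} (hw : 0 < w) (hw1 : w < 1) (hc : 0 < c) :
    Real.exp (-c * w) * Linf c w + Real.exp (c * (1 - w)) * Linf c (1 - w) = 1 := by
  have hlt : Real.exp (-(2 * c)) < 1 := by rw [Real.exp_lt_one_iff]; linarith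
  have h1 := Linf_eq hw hw1 hc
  have h2 := Linf_eq (w := 1 - w) (by linarith) (by linarith) hc
  have h3 : (Real.exp (-c * w) * Linf c w + Real.exp (c * (1 - w)) * Linf c (1 - w)) *
      (1 - Real.exp (-(2 * c))) = 1 * (1 - Real.exp (-(2 * c))) := by
    rw [add_mul, mul_assoc, mul_assoc, h1, h2, mul_sub (Real.exp _), mul_sub (Real.exp _), ← Real.exp_add, ← Real.exp_add,
      ← Real.exp_add, ← Real.exp_add]
    ring_nf
    rw [Real.exp_zero]; ring
  exact mul_right_cancel₀ (by linarith) h3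

lemma Linf_neg (c w : ℝ) : Linf (-c) w = Linf c w := by unfold Linf; rw [neg_sq]

lemma Linf_tendsto {w : ℝ} (hw : 0 < w) (hw1 : w < 1) :
    Tendsto (fun c => Linf c w) (𝓝[>] 0) (𝓝 (Linf 0 w)) := by
  unfold Linf
  refine tendsto_integral_filter_of_dominated_convergence (fun s => ‖phiDens s w‖) ?_ ?_
    (phi_integrable hw hw1).norm ?_
  · filter_upwards with c
    exact AEStronglyMeasurable.mul (by fun_prop) (phi_integrable hw hw1).aestronglyMeasurable
  · filter_upwards with c
    filter_upwards [ae_restrict_mem measurableSet_Ioi] with s hs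
    rw [norm_mul]
    refine mul_le_of_le_one_left (norm_nonneg _) ?_
    rw [Real.norm_eq_abs, abs_of_pos (Real.exp_pos _), Real.exp_le_one_iff]
    have : 0 ≤ c ^ 2 * s := mul_nonneg (sq_nonneg _) (le_of_lt hs)
    linarith
  · filter_upwards with s
    refine Tendsto.mul_const _ ?_
    have : Continuous (fun c : ℝ => Real.exp (-c ^ 2 * s)) := by fun_prop
    exact (this.tendsto 0).mono_left nhdsWithin_le_nhds

lemma Linf_total {w : ℝ} (hw : 0 < w) (hw1 : w < 1) (c : ℝ) :
    Real.exp (-c * w) * Linf c w + Real.exp (c * (1 - w)) * Linf c (1 - w) = 1 := by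
  rcases lt_trichotomy c 0 with h | h | h
  · have := Linf_total_pos (c := -c) (w := 1 - w) (by linarith) (by linarith) (by linarith)
    rw [Linf_neg, Linf_neg] at this
    rw [sub_sub_cancel, neg_neg] at this
    linarith
  · subst h
    have h1 : Tendsto (fun c : ℝ => Real.exp (-c * w) * Linf c w + Real.exp (c * (1 - w)) * Linf c (1 - w))
        (𝓝[>] 0) (𝓝 (Real.exp (-0 * w) * Linf 0 w + Real.exp (0 * (1 - w)) * Linf 0 (1 - w))) := by
      have e1 : Continuous (fun c : ℝ => Real.exp (-c * w)) := by fun_prop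
      have e2 : Continuous (fun c : ℝ => Real.exp (c * (1 - w))) := by fun_prop
      exact (((e1.tendsto 0).mono_left nhdsWithin_le_nhds).mul (Linf_tendsto hw hw1)).add
        (((e2.tendsto 0).mono_left nhdsWithin_le_nhds).mul
          (Linf_tendsto (w := 1 - w) (by linarith) (by linarith)))
    refine tendsto_nhds_unique h1 (tendsto_const_nhds.congr' ?_)
    filter_upwards [self_mem_nhdsWithin] with c hc
    exact (Linf_total_pos hw hw1 hc).symm
  · exact Linf_total_pos hw hw1 h

lemma ephi_cont (c : ℝ) {w : ℝ} (hw : 0 < w) (hw1 : w < 1) :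
    ContinuousOn (fun s => Real.exp (-c ^ 2 * s) * phiDens s w) (Ici 0) :=
  ContinuousOn.mul (by fun_prop) (phi_cont hw hw1)

lemma ephi_int (c : ℝ) {w : ℝ} (hw : 0 < w) (hw1 : w < 1) :
    IntegrableOn (fun s => Real.exp (-c ^ 2 * s) * phiDens s w) (Ioi 0) := by
  refine Integrable.mono (phi_integrable hw hw1)
    (AEStronglyMeasurable.mul (by fun_prop) (phi_integrable hw hw1).aestronglyMeasurable) ?_
  filter_upwards [ae_restrict_mem measurableSet_Ioi] with s hs
  rw [norm_mul]
  refine mul_le_of_le_one_left (norm_nonneg _) ?_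
  rw [Real.norm_eq_abs, abs_of_pos (Real.exp_pos _), Real.exp_le_one_iff]
  have : 0 ≤ c ^ 2 * s := mul_nonneg (sq_nonneg _) (le_of_lt hs)
  linarith

lemma Gt_deriv (c : ℝ) {w t : ℝ} (hw : 0 < w) (hw1 : w < 1) (ht : 0 < t) :
    HasDerivAt (Gt c w) (Real.exp (-c ^ 2 * t) * phiDens t w) t := by
  have hc := (ephi_cont c hw hw1)
  have h := intervalIntegral.integral_hasDerivAt_right (a := 0) (b := t)
    (f := fun s => Real.exp (-c ^ 2 * s) * phiDens s w) ?_ ?_ ?_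
  · refine h.congr_of_eventuallyEq ?_
    filter_upwards [Ioi_mem_nhds ht] with r hr
    rw [intervalIntegral.integral_of_le (le_of_lt hr)]; rfl
  · refine ContinuousOn.intervalIntegrable ?_
    rw [uIcc_of_le ht.le]
    exact hc.mono Icc_subset_Ici_self
  · exact (hc.mono Ioi_subset_Ici_self).stronglyMeasurableAtFilter isOpen_Ioi _ ht
  · exact hc.continuousAt (Ici_mem_nhds ht)

lemma Gt_cont (c : ℝ) {w : ℝ} (T : ℝ) (hw : 0 < w) (hw1 : w < 1) : ContinuousOn (Gt c w) (Icc 0 T) :=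
  intervalIntegral.continuousOn_primitive
    ((ephi_cont c hw hw1).mono Icc_subset_Ici_self).integrableOn_Icc

lemma Gt_top (c : ℝ) {w : ℝ} (hw : 0 < w) (hw1 : w < 1) : Tendsto (Gt c w) atTop (𝓝 (Linf c w)) := by
  refine (intervalIntegral_tendsto_integral_Ioi 0 (ephi_int c hw hw1) tendsto_id).congr' ?_
  filter_upwards [eventually_gt_atTop 0] with t ht
  rw [id, intervalIntegral.integral_of_le ht.le]; rfl

noncomputable def FF (c w t : ℝ) : ℝ :=
  Real.exp (-c * w) * Gt c w t + Real.exp (c * (1 - w)) * Gt c (1 - w) t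

noncomputable def gg (c w t : ℝ) : ℝ :=
  Real.exp (-c * w) * (Real.exp (-c ^ 2 * t) * phiDens t w) +
    Real.exp (c * (1 - w)) * (Real.exp (-c ^ 2 * t) * phiDens t (1 - w))

section
variable {w : ℝ} (c : ℝ) (hw : 0 < w) (hw1 : w < 1)

lemma Gt_bd1 {w t : ℝ} (c : ℝ) (hw : 0 < w) (hw1 : w < 1) (ht : 0 < t) :
    Real.exp (-c * w) * Gt c w t ≤ 1 ∧ (0 ≤ c → Real.exp (-c * w) * Gt c w t < 1) := by
  have hle := Gt_le (c := c) hw hw1 ht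
  have key : ∀ b, Gt c w t ≤ Real.exp b → Real.exp (-c * w) * Gt c w t ≤ Real.exp (-c * w + b) := by
    intro b hb
    rw [Real.exp_add]; gcongr
  rcases lt_trichotomy c 0 with h | h | h
  · have h1 := Pt_le' (c := -c) (t := t) hw (by linarith)
    have h2 : Pt (-c) w t = Pt c w t := by unfold Pt; rw [neg_sq]
    rw [h2] at h1
    have := key _ (hle.trans h1)
    rw [show -c * w + - -c * w = 0 by ring, Real.exp_zero] at this
    exact ⟨this, fun h' => absurd h' (by linarith)⟩
  · subst h
    have h1 := Pt_le (c := 0) (t := t) (d := w / (2 * t)) hw (by positivity)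
    rw [← Real.exp_add] at h1
    have h3 := key _ (hle.trans h1)
    have : Real.exp (-0 * w + ((w / (2 * t)) ^ 2 * t + -(w / (2 * t)) * w)) < 1 := by
      rw [Real.exp_lt_one_iff]
      have : -0 * w + ((w / (2 * t)) ^ 2 * t + -(w / (2 * t)) * w) = -(w ^ 2 / (4 * t)) := by
        field_simp; ring
      rw [this]
      have : 0 < w ^ 2 / (4 * t) := by positivity
      linarith
    exact ⟨(h3.trans_lt this).le, fun _ => h3.trans_lt this⟩
  · have h1 := Pt_le' (c := c) (t := t) hw h
    have h3 := key _ (hle.trans h1)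
    have : Real.exp (-c * w + -c * w) < 1 := by
      rw [Real.exp_lt_one_iff]; nlinarith
    exact ⟨by linarith, fun _ => by linarith⟩

include hw hw1

lemma FF_deriv {t : ℝ} (ht : 0 < t) : HasDerivAt (FF c w) (gg c w t) t :=
  ((Gt_deriv c hw hw1 ht).const_mul _).add
    ((Gt_deriv c (w := 1 - w) (by linarith) (by linarith) ht).const_mul _)

lemma FF_cont (T : ℝ) : ContinuousOn (FF c w) (Icc 0 T) :=
  (continuousOn_const.mul (Gt_cont c T hw hw1)).add
    (continuousOn_const.mul (Gt_cont c (w := 1 - w) T (by linarith) (by linarith)))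

lemma FF_zero : FF c w 0 = 0 := by simp [FF, Gt]

lemma FF_top : Tendsto (FF c w) atTop (𝓝 1) := by
  have := ((Gt_top c hw hw1).const_mul (Real.exp (-c * w))).add
    ((Gt_top c (w := 1 - w) (by linarith) (by linarith)).const_mul (Real.exp (c * (1 - w))))
  rw [Linf_total hw hw1 c] at this
  exact this

lemma FF_pos {t : ℝ} (ht : 0 < t) : 0 < FF c w t := by
  have h1 := Gt_pos (c := c) hw hw1 ht
  have h2 := Gt_pos (c := c) (w := 1 - w) (by linarith) (by linarith) ht
  unfold FF; positivity

lemma FF_lt_two {t : ℝ} (ht : 0 < t) : FF c w t < 2 := by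
  have h1 := Gt_bd1 c hw hw1 ht
  have h2 := Gt_bd1 (w := 1 - w) (-c) (by linarith) (by linarith) ht
  have h3 : Gt (-c) (1 - w) t = Gt c (1 - w) t := by unfold Gt; rw [neg_sq]
  rw [h3, neg_neg] at h2
  unfold FF
  rcases le_total 0 c with h | h
  · have := h1.2 h; linarith [h2.1]
  · have := h2.2 (by linarith); linarith [h1.1]

lemma FF_sep {δ : ℝ} (hδ : 0 < δ) : ∃ q, 0 ≤ q ∧ q < 1 ∧ ∀ t, δ ≤ t → |1 - FF c w t| ≤ q := by
  have h1 : ∀ᶠ t in atTop, |1 - FF c w t| < 1 / 2 := by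
    have := ((FF_top c hw hw1).const_sub 1).abs
    simp only [sub_self, abs_zero] at this
    exact this.eventually_lt_const (by norm_num)
  obtain ⟨T, hT⟩ := eventually_atTop.1 h1
  have hc : ContinuousOn (fun t => |1 - FF c w t|) (Icc δ (max T δ)) :=
    (continuousOn_const.sub ((FF_cont c hw hw1 (max T δ)).mono
      (Icc_subset_Icc_left hδ.le))).abs
  obtain ⟨x, hx, hmax⟩ := isCompact_Icc.exists_isMaxOn ⟨δ, le_rfl, le_max_right _ _⟩ hc
  have hx0 : 0 < x := hδ.trans_le hx.1
  refine ⟨max (|1 - FF c w x|) (1 / 2), by positivity, max_lt ?_ (by norm_num), fun t ht => ?_⟩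
  · rw [abs_lt]
    have := FF_pos c hw hw1 hx0
    have := FF_lt_two c hw hw1 hx0
    constructor <;> linarith
  · rcases le_total t (max T δ) with h | h
    · exact (hmax ⟨ht, h⟩).trans (le_max_left _ _)
    · exact (hT t ((le_max_left _ _).trans h)).le.trans (le_max_right _ _)

end

lemma ratio_pk {w β t : ℝ} (hw : 0 < w) (ht : 0 < t) (hβ : β * w ^ 2 = (1 - w) ^ 2) :
    pk (1 - w) t / pk w t = (1 - w) / w * Real.exp (-w ^ 2 / (4 * t)) ^ (β - 1) := by
  unfold pk
  have h1 : 0 < √(4 * π * t ^ 3) := by positivity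
  have : Real.exp (-(1 - w) ^ 2 / (4 * t)) = Real.exp (-w ^ 2 / (4 * t)) *
      Real.exp (-w ^ 2 / (4 * t)) ^ (β - 1) := by
    rw [← Real.exp_mul, ← Real.exp_add, ← hβ]; congr 1; ring
  rw [this]
  have h2 := Real.exp_pos (-w ^ 2 / (4 * t))
  field_simp

lemma E_tendsto {w : ℝ} (hw : 0 < w) :
    Tendsto (fun t : ℝ => Real.exp (-w ^ 2 / (4 * t))) (𝓝[>] 0) (𝓝 0) := by
  have h4 : Tendsto (fun s : ℝ => w ^ 2 / 4 * s⁻¹) (𝓝[>] 0) atTop :=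
    Tendsto.const_mul_atTop (by positivity) tendsto_inv_nhdsGT_zero
  refine (Real.tendsto_exp_neg_atTop_nhds_zero.comp h4).congr fun t => ?_
  simp only [Function.comp]
  congr 1
  rw [neg_div, mul_comm 4 t, ← div_div]; ring

section
variable {w β : ℝ} (c : ℝ) (hw : 0 < w) (hw1 : w < 1 / 2) (hβ : β * w ^ 2 = (1 - w) ^ 2)
  (hβ1 : 1 < β)
include hw hw1 hβ hβ1

lemma expc_tendsto : Tendsto (fun t : ℝ => Real.exp (-c ^ 2 * t)) (𝓝[>] 0) (𝓝 1) := by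
  have e2 : Continuous (fun t : ℝ => Real.exp (-c ^ 2 * t)) := by fun_prop
  have := (e2.tendsto 0).mono_left (nhdsWithin_le_nhds (s := Ioi 0))
  simpa using this

lemma ratio_tendsto : Tendsto (fun t : ℝ => pk (1 - w) t / pk w t) (𝓝[>] 0) (𝓝 0) := by
  have h := ((E_tendsto hw).rpow_const (p := β - 1) (Or.inr (by linarith))).const_mul ((1 - w) / w)
  rw [Real.zero_rpow (by linarith), mul_zero] at h
  refine h.congr' ?_
  filter_upwards [self_mem_nhdsWithin] with t ht
  exact (ratio_pk hw ht hβ).symm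

lemma gg_asymp : Tendsto (fun t : ℝ => gg c w t / (Real.exp (-c * w) * pk w t)) (𝓝[>] 0) (𝓝 1) := by
  have h1 := phi_asymp hw (by linarith)
  have h2 := phi_asymp (w := 1 - w) (by linarith) (by linarith)
  have h3 := (expc_tendsto c hw hw1 hβ hβ1).mul (h1.add ((h2.mul (ratio_tendsto hw hw1 hβ hβ1)).const_mul
    (Real.exp (c * (1 - w)) / Real.exp (-c * w))))
  simp only [mul_zero, add_zero, mul_one] at h3
  refine h3.congr' ?_
  filter_upwards [self_mem_nhdsWithin] with t ht
  have p1 := pk_pos hw ht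
  have p2 := pk_pos (x := 1 - w) (by linarith) ht
  have p3 := Real.exp_pos (-c * w)
  unfold gg
  field_simp

lemma FF_asymp : Tendsto (fun t : ℝ => FF c w t /
    (Real.exp (-c * w) * (2 / (w * √π)) * (√t * Real.exp (-w ^ 2 / (4 * t))))) (𝓝[>] 0) (𝓝 1) := by
  have hpi : 0 < √π := by positivity
  have hA := Real.exp_pos (-c * w)
  have hU' : ∀ t : ℝ, 0 < t → HasDerivAt
      (fun t => Real.exp (-c * w) * (2 / (w * √π)) * (√t * Real.exp (-w ^ 2 / (4 * t))))
      (Real.exp (-c * w) * pk w t * (1 + 2 * t / w ^ 2)) t := by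
    intro t ht
    have h1 := Real.hasDerivAt_sqrt ht.ne'
    have h2 : HasDerivAt (fun t : ℝ => -w ^ 2 / (4 * t)) (w ^ 2 / (4 * t ^ 2)) t := by
      have := (((hasDerivAt_id t).const_mul 4).inv (by simp; positivity)).const_mul (-w ^ 2)
      refine this.congr_deriv ?_
      simp; field_simp
    refine ((h1.mul h2.exp).const_mul (Real.exp (-c * w) * (2 / (w * √π)))).congr_deriv ?_
    have hr : 0 < √t := Real.sqrt_pos.2 ht
    have hsr : t = √t ^ 2 := (Real.sq_sqrt ht.le).symm
    have e3 : √(4 * π * t ^ 3) = 2 * √π * √t ^ 3 := by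
      rw [show 4 * π * t ^ 3 = π * (2 * √t ^ 3) ^ 2 by
        generalize √t = r at *
        subst hsr; ring]
      rw [Real.sqrt_mul pi_pos.le, Real.sqrt_sq (by positivity)]; ring
    unfold pk
    rw [e3]
    generalize Real.exp (-w ^ 2 / (4 * t)) = E
    generalize √t = r at *
    subst hsr
    field_simp
    ring
  refine HasDerivAt.lhopital_zero_nhdsGT (f' := gg c w)
    (g' := fun t => Real.exp (-c * w) * pk w t * (1 + 2 * t / w ^ 2)) ?_ ?_ ?_ ?_ ?_ ?_
  · filter_upwards [self_mem_nhdsWithin] with t ht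
    exact FF_deriv c hw (by linarith) ht
  · filter_upwards [self_mem_nhdsWithin] with t ht
    exact hU' t ht
  · filter_upwards [self_mem_nhdsWithin] with t ht
    have ht : 0 < t := ht
    have := pk_pos hw ht
    positivity
  · have h := (FF_cont c hw (by linarith) 1) 0 (by simp)
    unfold ContinuousWithinAt at h
    rw [FF_zero c hw (by linarith)] at h
    refine h.mono_left ?_
    rw [← nhdsWithin_Ioo_eq_nhdsGT (zero_lt_one' ℝ)]
    exact nhdsWithin_mono _ Ioo_subset_Icc_self
  · have h1 : Tendsto (fun s : ℝ => √s) (𝓝[>] 0) (𝓝 0) := by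
      have := (Real.continuous_sqrt.tendsto 0).mono_left (nhdsWithin_le_nhds (s := Ioi 0))
      simpa using this
    have := (h1.mul (E_tendsto hw)).const_mul (Real.exp (-c * w) * (2 / (w * √π)))
    simpa only [mul_zero] using this
  · have e2 : Continuous (fun t : ℝ => 1 + 2 * t / w ^ 2) := by fun_prop
    have e3 := (e2.tendsto 0).mono_left (nhdsWithin_le_nhds (s := Ioi 0))
    have := (gg_asymp c hw hw1 hβ hβ1).div e3 (by simp)
    simp only [mul_zero, zero_div, add_zero, div_one] at this
    refine this.congr fun t => ?_
    simp only [Pi.div_apply]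
    rw [div_div]

lemma FF_small : Tendsto (FF c w) (𝓝[>] 0) (𝓝 0) := by
  have h := (FF_cont c hw (by linarith) 1) 0 (by simp)
  unfold ContinuousWithinAt at h
  rw [FF_zero c hw (by linarith)] at h
  refine h.mono_left ?_
  rw [← nhdsWithin_Ioo_eq_nhdsGT (zero_lt_one' ℝ)]
  exact nhdsWithin_mono _ Ioo_subset_Icc_self

lemma tlog_FF : Tendsto (fun t : ℝ => t * -Real.log (FF c w t)) (𝓝[>] 0) (𝓝 (w ^ 2 / 4)) := by
  have hpi : 0 < √π := by positivity
  have hA := Real.exp_pos (-c * w)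
  have h0 : Tendsto (fun t : ℝ => t) (𝓝[>] 0) (𝓝 0) := tendsto_id.mono_left nhdsWithin_le_nhds
  have h1 := h0.mul ((FF_asymp c hw hw1 hβ hβ1).log one_ne_zero)
  have h2 := h0.mul_const (Real.log (Real.exp (-c * w) * (2 / (w * √π))))
  have h3 : Tendsto (fun t : ℝ => t * Real.log t) (𝓝[>] 0) (𝓝 0) := by
    have := (Real.continuous_mul_log.tendsto 0).mono_left (nhdsWithin_le_nhds (s := Ioi 0))
    simpa using this
  have h4 := (h1.add (h2.add (h3.const_mul (1 / 2)))).const_sub (w ^ 2 / 4)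
  simp only [mul_zero, zero_mul, add_zero, sub_zero] at h4
  refine h4.congr' ?_
  filter_upwards [self_mem_nhdsWithin] with t ht
  have ht : 0 < t := ht
  have hF := FF_pos c hw (by linarith) ht
  have hr : 0 < √t := Real.sqrt_pos.2 ht
  have hE := Real.exp_pos (-w ^ 2 / (4 * t))
  rw [Real.log_div hF.ne' (by positivity), Real.log_mul (x := Real.exp (-c * w) * (2 / (w * √π)))
    (by positivity) (by positivity), Real.log_mul hr.ne' hE.ne', Real.log_exp, Real.log_sqrt ht.le]
  field_simp
  ring

lemma ff_asymp : Tendsto (fun t : ℝ =>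
    Real.exp (c * (1 - w)) * (Real.exp (-c ^ 2 * t) * phiDens t (1 - w)) /
      (gg c w t * (FF c w t ^ (β - 1) * (-Real.log (FF c w t)) ^ ((β - 1) / 2)))) (𝓝[>] 0)
    (𝓝 (Real.exp (c * (1 - w)) * (1 - w) / (Real.exp (-c * w) * w) *
      (√π / Real.exp (-c * w)) ^ (β - 1))) := by
  have hpi : 0 < √π := by positivity
  have hA := Real.exp_pos (-c * w)
  have hX := ((FF_asymp c hw hw1 hβ hβ1).mul_const (Real.exp (-c * w) * (2 / (w * √π)))).mul
    (tlog_FF c hw hw1 hβ hβ1).sqrt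
  have e1 : 1 * (Real.exp (-c * w) * (2 / (w * √π))) * √(w ^ 2 / 4) = Real.exp (-c * w) / √π := by
    rw [show w ^ 2 / 4 = (w / 2) ^ 2 by ring, Real.sqrt_sq (by positivity)]
    field_simp
  rw [e1] at hX
  have hY := ((hX.rpow_const (p := β - 1) (Or.inl (by positivity))).inv₀ (by positivity))
  have h2 := phi_asymp (w := 1 - w) (by linarith) (by linarith)
  have hZ := ((expc_tendsto c hw hw1 hβ hβ1).mul h2).mul
    ((gg_asymp c hw hw1 hβ hβ1).inv₀ one_ne_zero)
  have hfin := (hZ.mul hY).const_mul (Real.exp (c * (1 - w)) * (1 - w) / (Real.exp (-c * w) * w))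
  have e2 : ((Real.exp (-c * w) / √π) ^ (β - 1))⁻¹ = (√π / Real.exp (-c * w)) ^ (β - 1) := by
    rw [← Real.inv_rpow (by positivity), inv_div]
  rw [e2] at hfin
  simp only [one_mul, inv_one] at hfin
  refine hfin.congr' ?_
  filter_upwards [self_mem_nhdsWithin, (FF_small c hw hw1 hβ hβ1).eventually_lt_const one_pos]
    with t ht hF1
  have ht : 0 < t := ht
  have hF := FF_pos c hw (by linarith) ht
  have hr : 0 < √t := Real.sqrt_pos.2 ht
  have hE := Real.exp_pos (-w ^ 2 / (4 * t))
  have hlog : 0 < -Real.log (FF c w t) := by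
    have := Real.log_neg hF hF1; linarith
  have hL : 0 < √(-Real.log (FF c w t)) := Real.sqrt_pos.2 hlog
  have e3 : FF c w t / (Real.exp (-c * w) * (2 / (w * √π)) * (√t * Real.exp (-w ^ 2 / (4 * t)))) *
      (Real.exp (-c * w) * (2 / (w * √π))) * √(t * -Real.log (FF c w t)) =
      (FF c w t * √(-Real.log (FF c w t))) / Real.exp (-w ^ 2 / (4 * t)) := by
    rw [Real.sqrt_mul ht.le]
    field_simp
  have e4 : (FF c w t ^ (β - 1) * (-Real.log (FF c w t)) ^ ((β - 1) / 2)) =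
      (FF c w t * √(-Real.log (FF c w t))) ^ (β - 1) := by
    rw [Real.mul_rpow hF.le hL.le, Real.sqrt_eq_rpow, ← Real.rpow_mul hlog.le]
    congr 2; ring
  have p1 := pk_pos hw ht
  have p2 := pk_pos (x := 1 - w) (by linarith) ht
  have e5 := ratio_pk hw ht hβ
  rw [e3, e4, Real.div_rpow (by positivity) hE.le]
  have hP : 0 < (FF c w t * √(-Real.log (FF c w t))) ^ (β - 1) := by positivity
  generalize (FF c w t * √(-Real.log (FF c w t))) ^ (β - 1) = P at *
  have hQ : 0 < Real.exp (-w ^ 2 / (4 * t)) ^ (β - 1) := by positivity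
  generalize Real.exp (-w ^ 2 / (4 * t)) ^ (β - 1) = Q at *
  rw [div_eq_iff p1.ne'] at e5
  rw [e5]
  by_cases hg : gg c w t = 0
  · simp [hg]
  have : 0 < 1 - w := by linarith
  field_simp

end

lemma log_bound {v γ : ℝ} (hv : 0 < v) (hγ : 0 ≤ γ) :
    (1 + |log v|) ^ γ ≤ (γ + 2) ^ γ * (v ^ (γ / (γ + 1)) + v ^ (-(γ / (γ + 1)))) := by
  have ha : 0 < 1 / (γ + 1) := by positivity
  have key : ∀ y : ℝ, 1 ≤ y → 1 + |log y| ≤ (γ + 2) * y ^ (1 / (γ + 1)) := by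
    intro y hy
    have h1 := Real.log_le_rpow_div (by linarith : 0 ≤ y) ha
    have h2 : 1 ≤ y ^ (1 / (γ + 1)) := Real.one_le_rpow hy ha.le
    rw [abs_of_nonneg (Real.log_nonneg hy)]
    have h3 : y ^ (1 / (γ + 1)) / (1 / (γ + 1)) = (γ + 1) * y ^ (1 / (γ + 1)) := by
      field_simp
    rw [h3] at h1
    linarith
  have key2 : ∀ y : ℝ, 1 ≤ y → (1 + |log y|) ^ γ ≤ (γ + 2) ^ γ * y ^ (γ / (γ + 1)) := by
    intro y hy
    calc (1 + |log y|) ^ γ ≤ ((γ + 2) * y ^ (1 / (γ + 1))) ^ γ :=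
          Real.rpow_le_rpow (by positivity) (key y hy) hγ
      _ = _ := by
          rw [Real.mul_rpow (by positivity) (by positivity), ← Real.rpow_mul (by linarith)]
          congr 2; field_simp
  rcases le_total 1 v with h | h
  · refine (key2 v h).trans ?_
    gcongr
    have : 0 < v ^ (-(γ / (γ + 1))) := by positivity
    linarith
  · have h1 := key2 v⁻¹ ((one_le_inv₀ hv).2 h)
    rw [Real.log_inv, abs_neg, Real.inv_rpow hv.le, ← Real.rpow_neg hv.le] at h1
    refine h1.trans ?_
    gcongr
    have : 0 < v ^ ((γ / (γ + 1))) := by positivity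
    linarith

lemma one_sub_div_pow_tendsto (v : ℝ) :
    Tendsto (fun N : ℕ => (1 - v / N) ^ (N - 1)) atTop (𝓝 (Real.exp (-v))) := by
  have h1 := Real.tendsto_one_add_div_pow_exp (-v)
  have h2 : Tendsto (fun N : ℕ => 1 - v / (N:ℝ)) atTop (𝓝 1) := by
    have := (tendsto_const_div_atTop_nhds_zero_nat v).const_sub 1
    simpa using this
  have h3 := h1.div h2 one_ne_zero
  rw [div_one] at h3
  refine h3.congr' ?_
  filter_upwards [h2.eventually (lt_mem_nhds (by norm_num : (0:ℝ) < 1)), eventually_ge_atTop 1]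
    with N hN hN1
  have e : 1 + -v / (N:ℝ) = 1 - v / N := by ring
  simp only [Pi.div_apply]
  rw [e]
  obtain ⟨m, rfl⟩ : ∃ m, N = m + 1 := ⟨N - 1, by omega⟩
  rw [pow_succ, Nat.add_sub_cancel]
  exact mul_div_cancel_right₀ _ hN.ne'

lemma KN {β γ u0 : ℝ} (hβ : 1 < β) (hγ : 0 ≤ γ) (h0 : 0 < u0) (h1 : u0 < 1) :
    Tendsto (fun N : ℕ => (∫ u in Ioo 0 u0, (1 - u) ^ (N - 1) * (u ^ (β - 1) * (-log u) ^ γ)) /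
      (log N ^ γ * (N:ℝ) ^ (-β))) atTop (𝓝 (Real.Gamma β)) := by
  set G : ℕ → ℝ → ℝ := fun N v => (Iio ((N:ℝ) * u0)).indicator
    (fun v => (1 - v / N) ^ (N - 1) * (v ^ (β - 1) * ((log N - log v) / log N) ^ γ)) v with hG
  set a := γ / (γ + 1) with ha
  have ha1 : a < 1 := by rw [ha, div_lt_one (by positivity)]; linarith
  have ha0 : 0 ≤ a := by positivity
  set bd : ℝ → ℝ := fun v => (γ + 2) ^ γ *
    (v ^ (β - 1 + a) * Real.exp (-(1/2) * v ^ (1:ℝ)) +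
      v ^ (β - 1 - a) * Real.exp (-(1/2) * v ^ (1:ℝ))) with hbd
  have hbdint : IntegrableOn bd (Ioi 0) := by
    refine Integrable.const_mul (Integrable.add ?_ ?_) _
    · exact integrableOn_rpow_mul_exp_neg_mul_rpow (by linarith) one_pos (by norm_num)
    · exact integrableOn_rpow_mul_exp_neg_mul_rpow (by linarith) one_pos (by norm_num)
  have hlogN : ∀ N : ℕ, 3 ≤ N → 1 ≤ log (N:ℝ) := by
    intro N hN
    rw [Real.le_log_iff_exp_le (by positivity)]
    have : (3:ℝ) ≤ N := by exact_mod_cast hN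
    linarith [Real.exp_one_lt_d9]
  have hlim : Tendsto (fun N => ∫ v in Ioi 0, G N v) atTop
      (𝓝 (∫ v in Ioi (0:ℝ), Real.exp (-v) * v ^ (β - 1))) := by
    refine tendsto_integral_filter_of_dominated_convergence bd ?_ ?_ hbdint ?_
    · refine Eventually.of_forall fun N => ?_
      refine Measurable.aestronglyMeasurable ?_
      refine Measurable.indicator ?_ measurableSet_Iio
      fun_prop
    · filter_upwards [eventually_ge_atTop 3] with N hN
      refine (ae_restrict_iff' measurableSet_Ioi).2 (Eventually.of_forall fun v hv => ?_)
      have hv : 0 < v := hv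
      have hL := hlogN N hN
      have hN3 : (3:ℝ) ≤ N := by exact_mod_cast hN
      have hbd0 : 0 ≤ bd v := by simp only [hbd]; positivity
      simp only [hG]
      by_cases hvN : v ∈ Iio ((N:ℝ) * u0)
      swap
      · rw [indicator_of_notMem hvN]; simpa using hbd0
      rw [indicator_of_mem hvN]
      have hvN : v < N * u0 := hvN
      have hvN' : v < N := by nlinarith
      have q0 : 0 ≤ 1 - v / N := by
        rw [sub_nonneg, div_le_one (by linarith)]; exact hvN'.le
      have hl : log v ≤ log N := Real.log_le_log hv hvN'.le
      have q1 : 0 ≤ (log N - log v) / log N := div_nonneg (by linarith) (by linarith)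
      have q2 : (log N - log v) / log N ≤ 1 + |log v| := by
        rw [div_le_iff₀ (by linarith)]
        nlinarith [neg_abs_le (log v), abs_nonneg (log v)]
      have q3 : (1 - v / N) ^ (N - 1) ≤ Real.exp (-(1/2) * v ^ (1:ℝ)) := by
        have : 1 - v / N ≤ Real.exp (-(v / N)) := by
          have := Real.add_one_le_exp (-(v / N)); linarith
        refine (pow_le_pow_left₀ q0 this _).trans ?_
        rw [← Real.exp_nat_mul, Real.rpow_one, Nat.cast_sub (by omega)]
        refine Real.exp_le_exp.2 ?_
        have : (((N:ℝ) - (1:ℕ)) * -(v / N)) = - v + v / N := by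
          field_simp; push_cast; ring
        rw [this]
        have : v / N ≤ v / 2 := div_le_div_of_nonneg_left hv.le (by norm_num) (by linarith)
        linarith
      have q4 : ((log N - log v) / log N) ^ γ ≤ (γ + 2) ^ γ * (v ^ a + v ^ (-a)) :=
        (Real.rpow_le_rpow q1 q2 hγ).trans (log_bound hv hγ)
      rw [Real.norm_of_nonneg (by positivity)]
      calc (1 - v / N) ^ (N - 1) * (v ^ (β - 1) * ((log N - log v) / log N) ^ γ)
          ≤ Real.exp (-(1/2) * v ^ (1:ℝ)) *
            (v ^ (β - 1) * ((γ + 2) ^ γ * (v ^ a + v ^ (-a)))) := by gcongr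
        _ = bd v := by
          simp only [hbd]
          rw [sub_eq_add_neg (β - 1) a, Real.rpow_add hv, Real.rpow_add hv]; ring
    · refine (ae_restrict_iff' measurableSet_Ioi).2 (Eventually.of_forall fun v hv => ?_)
      have hv : 0 < v := hv
      have hNt : Tendsto (fun N : ℕ => (N:ℝ)) atTop atTop := tendsto_natCast_atTop_atTop
      have hLt : Tendsto (fun N : ℕ => log (N:ℝ)) atTop atTop := Real.tendsto_log_atTop.comp hNt
      have t1 : Tendsto (fun N : ℕ => (log N - log v) / log N) atTop (𝓝 1) := by
        have : Tendsto (fun N : ℕ => 1 - log v / log N) atTop (𝓝 (1 - 0)) :=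
          (hLt.const_div_atTop (log v)).const_sub 1
        rw [sub_zero] at this
        refine this.congr' ?_
        filter_upwards [eventually_ge_atTop 3] with N hN
        have := hlogN N hN
        field_simp
      have t2 := t1.rpow_const (p := γ) (Or.inl one_ne_zero)
      rw [Real.one_rpow] at t2
      have t3 := (one_sub_div_pow_tendsto v).mul (t2.const_mul (v ^ (β - 1)))
      rw [mul_one] at t3
      refine t3.congr' ?_
      have : Tendsto (fun N : ℕ => (N:ℝ) * u0) atTop atTop := hNt.atTop_mul_const h0
      filter_upwards [this.eventually_gt_atTop v] with N hN
      simp only [hG]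
      rw [indicator_of_mem (show v ∈ Iio ((N:ℝ) * u0) from hN)]
  rw [← Real.Gamma_eq_integral (by linarith)] at hlim
  refine hlim.congr' ?_
  filter_upwards [eventually_ge_atTop 3] with N hN
  have hL := hlogN N hN
  have hN3 : (3:ℝ) ≤ N := by exact_mod_cast hN
  have hN0 : (0:ℝ) < N := by linarith
  set h : ℝ → ℝ := (Iio u0).indicator
    (fun u => (1 - u) ^ (N - 1) * (u ^ (β - 1) * (-log u) ^ γ)) with hh
  have e1 : ∫ u in Ioo 0 u0, (1 - u) ^ (N - 1) * (u ^ (β - 1) * (-log u) ^ γ) =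
      ∫ u in Ioi 0, h u := by
    rw [hh, setIntegral_indicator measurableSet_Iio, Ioi_inter_Iio]
  have e2 := integral_comp_mul_left_Ioi h 0 (inv_pos.2 hN0)
  rw [mul_zero, inv_inv, smul_eq_mul] at e2
  have e3 : ∫ v in Ioi 0, G N v =
      ∫ v in Ioi 0, ((N:ℝ) ^ (β - 1) * (log N ^ γ)⁻¹) * h ((N:ℝ)⁻¹ * v) := by
    refine setIntegral_congr_fun measurableSet_Ioi fun v hv => ?_
    have hv : 0 < v := hv
    simp only [hG, hh]
    by_cases hvN : v < N * u0
    · have hu : (N:ℝ)⁻¹ * v < u0 := by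
        rw [inv_mul_lt_iff₀ hN0]; exact hvN
      have hvN' : v < N := by nlinarith
      have hl : log v ≤ log N := Real.log_le_log hv hvN'.le
      rw [indicator_of_mem (show v ∈ Iio ((N:ℝ) * u0) from hvN), indicator_of_mem (show _ ∈ Iio u0 from hu)]
      rw [Real.mul_rpow (by positivity) hv.le, Real.inv_rpow hN0.le,
        Real.log_mul (by positivity) hv.ne', Real.log_inv,
        Real.div_rpow (by linarith) (by linarith)]
      have : -(-log (N:ℝ) + log v) = log N - log v := by ring
      rw [this]
      have : (N:ℝ)⁻¹ * v = v / N := by ring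
      rw [this]
      have : (N:ℝ) ^ (β - 1) ≠ 0 := by positivity
      field_simp
    · have hu : ¬ (N:ℝ)⁻¹ * v < u0 := by
        rw [inv_mul_lt_iff₀ hN0]; exact hvN
      rw [indicator_of_notMem (show v ∉ Iio ((N:ℝ) * u0) from hvN), indicator_of_notMem (show _ ∉ Iio u0 from hu)]
      simp
  rw [e3, e1, integral_const_mul, e2, Real.rpow_neg hN0.le, Real.rpow_sub_one hN0.ne']
  have : (N:ℝ) ^ β ≠ 0 := by positivity
  have : log (N:ℝ) ^ γ ≠ 0 := by positivity
  field_simp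

lemma step_abs {F g f : ℝ → ℝ} {β γ C : ℝ} (hC : 0 < C)
    (hF0 : F 0 = 0) (hFc : ∀ T, ContinuousOn F (Icc 0 T))
    (hFd : ∀ t, 0 < t → HasDerivAt F (g t) t) (hFp : ∀ t, 0 < t → 0 < F t)
    (hF2 : ∀ t, 0 < t → F t < 2)
    (hsep : ∀ δ, 0 < δ → ∃ q, 0 ≤ q ∧ q < 1 ∧ ∀ t, δ ≤ t → |1 - F t| ≤ q)
    (hgp : ∀ᶠ t in 𝓝[>] (0:ℝ), 0 < g t) (hsm : Tendsto F (𝓝[>] 0) (𝓝 0))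
    (hgc : ContinuousOn g (Ioi 0)) (hf : IntegrableOn f (Ioi 0))
    (hlim : Tendsto (fun t => f t / (g t * (F t ^ (β - 1) * (-log (F t)) ^ γ))) (𝓝[>] 0) (𝓝 C))
    {ε : ℝ} (hε : 0 < ε) (hε1 : ε ≤ 1 / 2) :
    ∃ u0 q M, 0 < u0 ∧ u0 < 1 ∧ 0 < q ∧ q < 1 ∧ 0 ≤ M ∧ ∀ N : ℕ,
      |(∫ t in Ioi 0, (1 - F t) ^ N * f t) -
        C * ∫ u in Ioo 0 u0, (1 - u) ^ N * (u ^ (β - 1) * (-log u) ^ γ)| ≤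
      ε * (C * ∫ u in Ioo 0 u0, (1 - u) ^ N * (u ^ (β - 1) * (-log u) ^ γ)) + q ^ N * M := by
  set ρ : ℝ → ℝ := fun u => u ^ (β - 1) * (-log u) ^ γ with hρ
  have hρm : Measurable ρ := by simp only [hρ]; fun_prop
  have hρp : ∀ u, 0 < u → u < 1 → 0 < ρ u := by
    intro u h0 h1
    have := Real.log_neg h0 h1
    have : 0 < -log u := by linarith
    simp only [hρ]; positivity
  have ev : ∀ᶠ t in 𝓝[>] (0:ℝ), 0 < g t ∧ F t < 1 ∧
      |f t - C * (ρ (F t) * g t)| ≤ ε * (C * (ρ (F t) * g t)) := by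
    have e1 := (Metric.tendsto_nhds.1 hlim) (ε * C) (by positivity)
    filter_upwards [hgp, hsm.eventually_lt_const one_pos, e1, self_mem_nhdsWithin]
      with t h1 h2 h3 h4
    refine ⟨h1, h2, ?_⟩
    have hp := hρp _ (hFp t h4) h2
    have hgr : 0 < g t * ρ (F t) := by positivity
    have h3 : |f t / (g t * ρ (F t)) - C| < ε * C := h3
    have : f t - C * (ρ (F t) * g t) = (f t / (g t * ρ (F t)) - C) * (g t * ρ (F t)) := by
      field_simp
    rw [this, abs_mul, abs_of_pos hgr]
    nlinarith
  obtain ⟨δ', hδ', hsub⟩ := mem_nhdsGT_iff_exists_Ioo_subset.1 ev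
  have hδ'0 : 0 < δ' := hδ'
  set δ := δ' / 2 with hδd
  have hδ : 0 < δ := by positivity
  have hall : ∀ t, 0 < t → t ≤ δ → 0 < g t ∧ F t < 1 ∧
      |f t - C * (ρ (F t) * g t)| ≤ ε * (C * (ρ (F t) * g t)) := fun t h0 h1 =>
    hsub ⟨h0, by linarith⟩
  obtain ⟨q, hq0, hq1, hq⟩ := hsep δ hδ
  have hmono : StrictMonoOn F (Icc 0 δ) := by
    refine strictMonoOn_of_deriv_pos (convex_Icc _ _) (hFc δ) fun x hx => ?_
    rw [interior_Icc] at hx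
    rw [(hFd x hx.1).deriv]
    exact (hall x hx.1 hx.2.le).1
  have himg : F '' Ioo 0 δ = Ioo 0 (F δ) := by
    apply Subset.antisymm
    · rintro _ ⟨t, ht, rfl⟩
      exact ⟨hFp t ht.1, hmono ⟨ht.1.le, ht.2.le⟩ ⟨hδ.le, le_rfl⟩ ht.2⟩
    · have := intermediate_value_Ioo hδ.le (hFc δ)
      rwa [hF0] at this
  have hFcI : ContinuousOn F (Ioi 0) := fun t ht => (hFd t ht).continuousAt.continuousWithinAt
  have hFm : AEStronglyMeasurable F (volume.restrict (Ioi 0)) :=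
    hFcI.aestronglyMeasurable measurableSet_Ioi
  have hgm : AEStronglyMeasurable g (volume.restrict (Ioi 0)) :=
    hgc.aestronglyMeasurable measurableSet_Ioi
  have hss : Ioo 0 δ ⊆ Ioi 0 := fun t ht => ht.1
  have hss2 : Ici δ ⊆ Ioi 0 := fun t ht => lt_of_lt_of_le hδ ht
  refine ⟨F δ, (q + 1) / 2, ∫ t in Ici δ, |f t|, hFp δ hδ, (hall δ hδ le_rfl).2.1,
    by linarith, by linarith, integral_nonneg fun _ => abs_nonneg _, fun N => ?_⟩
  have hcv : ∫ u in Ioo 0 (F δ), (1 - u) ^ N * ρ u =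
      ∫ t in Ioo 0 δ, (1 - F t) ^ N * (ρ (F t) * g t) := by
    rw [← himg, integral_image_eq_integral_abs_deriv_smul measurableSet_Ioo
      (fun x hx => (hFd x hx.1).hasDerivWithinAt)
      (hmono.injOn.mono Ioo_subset_Icc_self)]
    refine setIntegral_congr_fun measurableSet_Ioo fun t ht => ?_
    simp only [smul_eq_mul]
    rw [abs_of_pos (hall t ht.1 ht.2.le).1]; ring
  have hpm : AEStronglyMeasurable (fun t => (1 - F t) ^ N) (volume.restrict (Ioi 0)) :=
    (aestronglyMeasurable_const.sub hFm).pow N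
  have hp1 : ∀ t, 0 < t → |(1 - F t) ^ N| ≤ 1 := by
    intro t ht
    rw [abs_pow]
    refine pow_le_one₀ (abs_nonneg _) (abs_le.2 ⟨?_, ?_⟩)
    · linarith [hF2 t ht]
    · linarith [hFp t ht]
  have hint1 : IntegrableOn (fun t => (1 - F t) ^ N * f t) (Ioi 0) := by
    refine Integrable.bdd_mul (c := 1) hf hpm ?_
    filter_upwards [ae_restrict_mem measurableSet_Ioi] with t ht
    exact hp1 t ht
  have hint2 : IntegrableOn (fun t => (1 - F t) ^ N * (ρ (F t) * g t)) (Ioo 0 δ) := by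
    have hfa : IntegrableOn (fun t => (2 / C) * |f t|) (Ioo 0 δ) :=
      ((hf.mono_set hss).abs).const_mul _
    have hm : AEStronglyMeasurable (fun t => (1 - F t) ^ N * (ρ (F t) * g t))
        (volume.restrict (Ioo 0 δ)) := by
      refine AEStronglyMeasurable.mono_measure ?_ (Measure.restrict_mono hss le_rfl)
      refine hpm.mul (AEStronglyMeasurable.mul ?_ hgm)
      exact (hρm.comp_aemeasurable hFm.aemeasurable).aestronglyMeasurable
    refine Integrable.mono' hfa hm ?_
    filter_upwards [ae_restrict_mem measurableSet_Ioo] with t ht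
    obtain ⟨h1, h2, h3⟩ := hall t ht.1 ht.2.le
    have hp := hρp _ (hFp t ht.1) h2
    have hP : 0 < ρ (F t) * g t := by positivity
    rw [Real.norm_eq_abs, abs_mul, abs_of_pos hP]
    have h4 : C * (ρ (F t) * g t) ≤ 2 * |f t| := by
      have := (abs_le.1 h3).1
      have h5 : 0 < C * (ρ (F t) * g t) := by positivity
      have := le_abs_self (f t)
      nlinarith
    have h6 : ρ (F t) * g t ≤ 2 / C * |f t| := by
      rw [div_mul_eq_mul_div, le_div_iff₀ hC]; linarith
    have := hp1 t ht.1
    nlinarith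
  have hsplit : ∫ t in Ioi 0, (1 - F t) ^ N * f t =
      (∫ t in Ioo 0 δ, (1 - F t) ^ N * f t) + ∫ t in Ici δ, (1 - F t) ^ N * f t := by
    rw [← setIntegral_union _ measurableSet_Ici (hint1.mono_set hss) (hint1.mono_set hss2),
      Ioo_union_Ici_eq_Ioi hδ]
    exact disjoint_left.2 fun t h1 h2 => absurd h1.2 (not_lt.2 h2)
  have htail : |∫ t in Ici δ, (1 - F t) ^ N * f t| ≤ ((q + 1) / 2) ^ N * ∫ t in Ici δ, |f t| := by
    rw [← integral_const_mul, ← Real.norm_eq_abs]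
    refine norm_integral_le_of_norm_le (((hf.mono_set hss2).abs).const_mul _) ?_
    filter_upwards [ae_restrict_mem measurableSet_Ici] with t ht
    rw [norm_mul, norm_pow]
    refine mul_le_mul_of_nonneg_right ?_ (abs_nonneg _)
    refine pow_le_pow_left₀ (norm_nonneg _) ?_ _
    have := hq t ht
    rw [Real.norm_eq_abs]; linarith
  have hmain : |(∫ t in Ioo 0 δ, (1 - F t) ^ N * f t) -
      C * ∫ t in Ioo 0 δ, (1 - F t) ^ N * (ρ (F t) * g t)| ≤
      ε * (C * ∫ t in Ioo 0 δ, (1 - F t) ^ N * (ρ (F t) * g t)) := by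
    rw [← integral_const_mul, ← integral_const_mul,
      ← integral_sub (hint1.mono_set hss) (hint2.const_mul C), ← Real.norm_eq_abs]
    refine norm_integral_le_of_norm_le ((hint2.const_mul C).const_mul ε) ?_
    filter_upwards [ae_restrict_mem measurableSet_Ioo] with t ht
    obtain ⟨h1, h2, h3⟩ := hall t ht.1 ht.2.le
    have e : (1 - F t) ^ N * f t - C * ((1 - F t) ^ N * (ρ (F t) * g t)) =
      (1 - F t) ^ N * (f t - C * (ρ (F t) * g t)) := by ring
    have hn : 0 ≤ (1 - F t) ^ N := pow_nonneg (by linarith) _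
    rw [e, Real.norm_eq_abs, abs_mul, abs_of_nonneg hn]
    calc _ ≤ (1 - F t) ^ N * (ε * (C * (ρ (F t) * g t))) := by gcongr
      _ = _ := by ring
  rw [hcv, hsplit]
  have e : ∀ a b c : ℝ, a + b - c = (a - c) + b := fun a b c => by ring
  rw [e]
  exact (abs_add_le _ _).trans (add_le_add hmain htail)

lemma tail_zero {β γ q : ℝ} (hγ : 0 ≤ γ) (M : ℝ) (hq : 0 < q) (hq1 : q < 1) :
    Tendsto (fun N : ℕ => q ^ (N - 1) * M / (log N ^ γ * (N:ℝ) ^ (-β))) atTop (𝓝 0) := by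
  obtain ⟨k, hk⟩ := exists_nat_ge β
  have h1 := (tendsto_pow_const_mul_const_pow_of_abs_lt_one k
    (by rwa [abs_of_pos hq] : |q| < 1)).const_mul (|M| / q)
  rw [mul_zero] at h1
  refine squeeze_zero_norm' ?_ h1
  filter_upwards [eventually_ge_atTop 3] with N hN
  have hN3 : (3:ℝ) ≤ N := by exact_mod_cast hN
  have hN0 : (0:ℝ) < N := by linarith
  have hL : 1 ≤ log (N:ℝ) := by
    rw [Real.le_log_iff_exp_le hN0]
    linarith [Real.exp_one_lt_d9]
  have hLg : 1 ≤ log (N:ℝ) ^ γ := Real.one_le_rpow hL hγ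
  have hNb : (N:ℝ) ^ β ≤ (N:ℝ) ^ k := by
    rw [← Real.rpow_natCast]
    exact Real.rpow_le_rpow_of_exponent_le (by linarith) hk
  have hs : 0 < log (N:ℝ) ^ γ * (N:ℝ) ^ (-β) := by positivity
  rw [Real.norm_eq_abs, abs_div, abs_of_pos hs, div_le_iff₀ hs, abs_mul, abs_of_pos (pow_pos hq _)]
  have e : q ^ (N - 1) = q ^ N / q := by
    rw [eq_div_iff hq.ne', ← pow_succ]; congr 1; omega
  rw [e, Real.rpow_neg hN0.le]
  have hb : (0:ℝ) < (N:ℝ) ^ β := by positivity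
  have h2 : 1 ≤ (N:ℝ) ^ k * (log (N:ℝ) ^ γ * ((N:ℝ) ^ β)⁻¹) := by
    have : 1 ≤ (N:ℝ) ^ k * ((N:ℝ) ^ β)⁻¹ := by
      rw [← div_eq_mul_inv, one_le_div hb]; exact hNb
    nlinarith
  have h3 : 0 ≤ q ^ N / q * |M| := by positivity
  calc q ^ N / q * |M| ≤ q ^ N / q * |M| * ((N:ℝ) ^ k * (log (N:ℝ) ^ γ * ((N:ℝ) ^ β)⁻¹)) :=
        le_mul_of_one_le_right h3 h2
    _ = _ := by ring

lemma main_abs {F g f : ℝ → ℝ} {β γ C : ℝ} (hC : 0 < C) (hβ : 1 < β) (hγ : 0 ≤ γ)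
    (hF0 : F 0 = 0) (hFc : ∀ T, ContinuousOn F (Icc 0 T))
    (hFd : ∀ t, 0 < t → HasDerivAt F (g t) t) (hFp : ∀ t, 0 < t → 0 < F t)
    (hF2 : ∀ t, 0 < t → F t < 2)
    (hsep : ∀ δ, 0 < δ → ∃ q, 0 ≤ q ∧ q < 1 ∧ ∀ t, δ ≤ t → |1 - F t| ≤ q)
    (hgp : ∀ᶠ t in 𝓝[>] (0:ℝ), 0 < g t) (hsm : Tendsto F (𝓝[>] 0) (𝓝 0))
    (hgc : ContinuousOn g (Ioi 0)) (hf : IntegrableOn f (Ioi 0))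
    (hlim : Tendsto (fun t => f t / (g t * (F t ^ (β - 1) * (-log (F t)) ^ γ)))
      (𝓝[>] 0) (𝓝 C)) :
    Tendsto (fun N : ℕ => (∫ t in Ioi 0, (1 - F t) ^ (N - 1) * f t) /
      (log N ^ γ * (N:ℝ) ^ (-β))) atTop (𝓝 (C * Real.Gamma β)) := by
  set K := C * Real.Gamma β with hK
  have hK0 : 0 < K := mul_pos hC (Real.Gamma_pos_of_pos (by linarith))
  refine Metric.tendsto_nhds.2 fun e he => ?_
  set ε := min (1 / 2) (e / (4 * K)) with hεd
  have hε : 0 < ε := by positivity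
  have hεe : ε * K ≤ e / 4 := by
    have : ε ≤ e / (4 * K) := min_le_right _ _
    rw [le_div_iff₀ (by positivity)] at this; linarith
  obtain ⟨u0, q, M, hu0, hu1, hq0, hq1, hM, hst⟩ := step_abs hC hF0 hFc hFd hFp hF2 hsep hgp hsm hgc hf
    hlim hε (min_le_left _ _)
  have t1 := (KN hβ hγ hu0 hu1).const_mul C
  have t2 := tail_zero (β := β) hγ M hq0 hq1
  have t3 := (Metric.tendsto_nhds.1 t1) (e / 4) (by positivity)
  have t4 := (t1.const_mul ε).eventually_lt_const (show ε * K < e / 2 by linarith)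
  have t5 := t2.eventually_lt_const (show (0:ℝ) < e / 4 by positivity)
  filter_upwards [t3, t4, t5, eventually_ge_atTop 3] with N h3 h4 h5 hN
  have hN3 : (3:ℝ) ≤ N := by exact_mod_cast hN
  have hL : 0 < log (N:ℝ) := Real.log_pos (by linarith)
  have hs : 0 < log (N:ℝ) ^ γ * (N:ℝ) ^ (-β) := by positivity
  have hb := hst (N - 1)
  set I := ∫ t in Ioi 0, (1 - F t) ^ (N - 1) * f t
  set J := ∫ u in Ioo 0 u0, (1 - u) ^ (N - 1) * (u ^ (β - 1) * (-log u) ^ γ)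
  set s := log (N:ℝ) ^ γ * (N:ℝ) ^ (-β)
  rw [Real.dist_eq] at h3 ⊢
  have hb' : |I / s - C * (J / s)| ≤ ε * (C * (J / s)) + q ^ (N - 1) * M / s := by
    have e1 : I / s - C * (J / s) = (I - C * J) / s := by ring
    have e2 : ε * (C * (J / s)) + q ^ (N - 1) * M / s = (ε * (C * J) + q ^ (N - 1) * M) / s := by
      ring
    rw [e1, e2, abs_div, abs_of_pos hs]
    gcongr
  calc |I / s - K| = |(I / s - C * (J / s)) + (C * (J / s) - K)| := by congr 1; ring
    _ ≤ _ := abs_add_le _ _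
    _ < e := by linarith

lemma main_norm {w β : ℝ} (c : ℝ) (hw : 0 < w) (hw1 : w < 1 / 2) (hβ : β * w ^ 2 = (1 - w) ^ 2)
    (hβ1 : 1 < β) :
    Tendsto (fun N : ℕ => (∫ t in Ioi 0, (1 - FF c w t) ^ (N - 1) *
        (Real.exp (c * (1 - w)) * (Real.exp (-c ^ 2 * t) * phiDens t (1 - w)))) /
      (log N ^ ((β - 1) / 2) * (N:ℝ) ^ (-β))) atTop
      (𝓝 (Real.exp (c * (1 - w)) * (1 - w) / (Real.exp (-c * w) * w) *
        (√π / Real.exp (-c * w)) ^ (β - 1) * Real.Gamma β)) := by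
  have hw' : w < 1 := by linarith
  have h1w : 0 < 1 - w := by linarith
  refine main_abs (g := gg c w) ?_ hβ1 (by linarith) (FF_zero c hw hw') (FF_cont c hw hw')
    (fun t ht => FF_deriv c hw hw' ht) (fun t ht => FF_pos c hw hw' ht)
    (fun t ht => FF_lt_two c hw hw' ht) (fun δ hδ => FF_sep c hw hw' hδ) ?_
    (FF_small c hw hw1 hβ hβ1) ?_ ?_ (ff_asymp c hw hw1 hβ hβ1)
  · have := Real.pi_pos
    positivity
  · filter_upwards [(gg_asymp c hw hw1 hβ hβ1).eventually (lt_mem_nhds (one_half_lt_one)),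
      self_mem_nhdsWithin] with t ht h0
    have hp : 0 < Real.exp (-c * w) * pk w t := mul_pos (Real.exp_pos _) (pk_pos hw h0)
    by_contra hneg
    have := div_nonpos_of_nonpos_of_nonneg (not_lt.1 hneg) hp.le
    linarith
  · refine ContinuousOn.add (continuousOn_const.mul ?_) (continuousOn_const.mul ?_)
    · exact (ephi_cont c hw hw').mono Ioi_subset_Ici_self
    · exact (ephi_cont c h1w (by linarith)).mono Ioi_subset_Ici_self
  · exact (ephi_int c h1w (by linarith)).const_mul _

lemma Gt_scale {a c w t : ℝ} (ha : 0 < a) (ht : 0 < t) :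
    ∫ s in Ioc 0 t, Real.exp (-c ^ 2 * (a * s)) * a * phiDens (a * s) w = Gt c w (a * t) := by
  unfold Gt
  rw [← intervalIntegral.integral_of_le ht.le, ← intervalIntegral.integral_of_le (by positivity)]
  have := intervalIntegral.integral_comp_mul_left (a := 0) (b := t)
    (fun s => Real.exp (-c ^ 2 * s) * phiDens s w) ha.ne'
  rw [mul_zero, smul_eq_mul] at this
  have h2 : ∫ s in (0:ℝ)..(a * t), Real.exp (-c ^ 2 * s) * phiDens s w =
      a * ∫ s in (0:ℝ)..t, Real.exp (-c ^ 2 * (a * s)) * phiDens (a * s) w := by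
    rw [this, mul_inv_cancel_left₀ ha.ne']
  rw [h2, ← intervalIntegral.integral_const_mul]
  congr 1; ext s; ring

theorem extreme_hitting_asymptotics_drift
    (μ D l x₀ : ℝ) (hD : 0 < D) (hl : 0 < l) (hx₀ : 0 < x₀) (hx₀l : x₀ < l / 2)
    (F f₁ : ℝ → ℝ)
    (hF : ∀ t : ℝ, F t =
        Real.exp (-μ * x₀ / (2 * D)) *
          (∫ s in Ioc (0 : ℝ) t,
            Real.exp (-μ ^ 2 * s / (4 * D)) * (D / l ^ 2) *
              phiDens (D * s / l ^ 2) (x₀ / l))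
        + Real.exp (μ * (l - x₀) / (2 * D)) *
          (∫ s in Ioc (0 : ℝ) t,
            Real.exp (-μ ^ 2 * s / (4 * D)) * (D / l ^ 2) *
              phiDens (D * s / l ^ 2) (1 - x₀ / l)))
    (hf₁ : ∀ t : ℝ, f₁ t =
        Real.exp (μ * (l - x₀) / (2 * D)) * Real.exp (-μ ^ 2 * t / (4 * D)) *
          (D / l ^ 2) * phiDens (D * t / l ^ 2) (1 - x₀ / l))
    (β η : ℝ) (hβ : β = ((l - x₀) / x₀) ^ 2)
    (hη : η = Real.exp (μ * l * Real.sqrt β / (2 * D)) *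
        Real.sqrt (β * Real.pi ^ (β - 1)) * Real.Gamma β) :
    1 < β ∧ 0 < η ∧
      Tendsto
        (fun N : ℕ =>
          ((N : ℝ) * ∫ t in Ioi (0 : ℝ), (1 - F t) ^ (N - 1) * f₁ t) /
            (η * Real.log N ^ ((β - 1) / 2) * (N : ℝ) ^ (1 - β)))
        atTop (𝓝 1) := by
  have hr1 : 1 < (l - x₀) / x₀ := by rw [one_lt_div hx₀]; linarith
  have hβ1 : 1 < β := by rw [hβ]; nlinarith
  have hβ0 : 0 < β := by linarith
  have hG := Real.Gamma_pos_of_pos hβ0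
  have hpi := Real.pi_pos
  have hη0 : 0 < η := by rw [hη]; positivity
  refine ⟨hβ1, hη0, ?_⟩
  set w := x₀ / l with hwd
  set c := μ * l / (2 * D) with hcd
  set a := D / l ^ 2 with had
  have ha : 0 < a := by positivity
  have hw : 0 < w := by positivity
  have hw1 : w < 1 / 2 := by rw [hwd, div_lt_iff₀ hl]; linarith
  have hr : (l - x₀) / x₀ = (1 - w) / w := by rw [hwd]; field_simp
  have hβw : β * w ^ 2 = (1 - w) ^ 2 := by rw [hβ, hr]; field_simp
  have hsq : √β = (1 - w) / w := by
    rw [hβ, Real.sqrt_sq (by linarith), hr]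
  have E1 : ∀ s, Real.exp (-μ ^ 2 * s / (4 * D)) = Real.exp (-c ^ 2 * (a * s)) := by
    intro s; congr 1; rw [hcd, had]; field_simp; try ring
  have E2 : Real.exp (-μ * x₀ / (2 * D)) = Real.exp (-c * w) := by
    congr 1; rw [hcd, hwd]; field_simp
  have E3 : Real.exp (μ * (l - x₀) / (2 * D)) = Real.exp (c * (1 - w)) := by
    congr 1; rw [hcd, hwd]; field_simp
  have E4 : ∀ s, D * s / l ^ 2 = a * s := by intro s; rw [had]; ring
  have hFF : ∀ t, 0 < t → F t = FF c w (a * t) := by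
    intro t ht
    rw [hF t]
    simp only [E1, E2, E3, E4]
    rw [Gt_scale ha ht, Gt_scale ha ht]; rfl
  set f : ℝ → ℝ := fun t =>
    Real.exp (c * (1 - w)) * (Real.exp (-c ^ 2 * t) * phiDens t (1 - w)) with hf
  have hint : ∀ N : ℕ, ∫ t in Ioi (0 : ℝ), (1 - F t) ^ (N - 1) * f₁ t =
      ∫ t in Ioi (0:ℝ), (1 - FF c w t) ^ (N - 1) * f t := by
    intro N
    have h := integral_comp_mul_left_Ioi (fun t => (1 - FF c w t) ^ (N - 1) * f t) 0 ha
    rw [mul_zero, smul_eq_mul] at h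
    have h2 : ∫ t in Ioi (0:ℝ), (1 - FF c w t) ^ (N - 1) * f t =
        a * ∫ t in Ioi (0:ℝ), (1 - FF c w (a * t)) ^ (N - 1) * f (a * t) := by
      rw [h, mul_inv_cancel_left₀ ha.ne']
    rw [h2, ← integral_const_mul]
    refine setIntegral_congr_fun measurableSet_Ioi fun t ht => ?_
    simp only [hf]
    rw [hFF t ht, hf₁ t, E1, E3, E4]; ring
  have hηC : η = Real.exp (c * (1 - w)) * (1 - w) / (Real.exp (-c * w) * w) *
        (√π / Real.exp (-c * w)) ^ (β - 1) * Real.Gamma β := by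
    rw [hη, Real.sqrt_mul hβ0.le, hsq]
    have s1 : √(π ^ (β - 1)) = √π ^ (β - 1) := by
      rw [Real.sqrt_eq_rpow, Real.sqrt_eq_rpow, ← Real.rpow_mul hpi.le, ← Real.rpow_mul hpi.le]
      congr 1; ring
    rw [s1, Real.div_rpow (Real.sqrt_nonneg _) (Real.exp_pos _).le, ← Real.exp_mul]
    have s2 : Real.exp (μ * l * ((1 - w) / w) / (2 * D)) =
        Real.exp (c * (1 - w)) / (Real.exp (-c * w) * Real.exp (-c * w * (β - 1))) := by
      rw [← Real.exp_add, ← Real.exp_sub]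
      congr 1
      have e1 : μ * l * ((1 - w) / w) / (2 * D) = c * ((1 - w) / w) := by rw [hcd]; ring
      have e2 : w * β = (1 - w) ^ 2 / w := by
        rw [← hβw]; field_simp
      have e3 : c * (1 - w) - (-c * w + -c * w * (β - 1)) = c * (1 - w + w * β) := by ring
      rw [e1, e3, e2]; field_simp; ring
    rw [s2]
    field_simp
  have hmain := main_norm c hw hw1 hβw hβ1
  rw [← hηC] at hmain
  have hd := hmain.div_const η
  rw [div_self hη0.ne'] at hd
  refine hd.congr' ?_
  filter_upwards [eventually_ge_atTop 3] with N hN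
  have hN3 : (3:ℝ) ≤ N := by exact_mod_cast hN
  have hN0 : (0:ℝ) < N := by linarith
  have hL : 0 < log (N:ℝ) := Real.log_pos (by linarith)
  rw [hint N, sub_eq_add_neg 1 β, Real.rpow_add hN0, Real.rpow_one]
  have : 0 < log (N:ℝ) ^ ((β - 1) / 2) := by positivity
  have : 0 < (N:ℝ) ^ (-β) := by positivity
  change (∫ t in Ioi (0:ℝ), (1 - FF c w t) ^ (N - 1) * f t) /
    (log (N:ℝ) ^ ((β - 1) / 2) * (N:ℝ) ^ (-β)) / η = _
  generalize (∫ t in Ioi (0:ℝ), (1 - FF c w t) ^ (N - 1) * f t) = I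
  field_simp
end

section
/- Let erfc(z) := (2/√π) ∫_z^∞ e^{−u²} du. Fix D > 0, γ > 0, and x > 0, and define u(x, t) := erfc(x/√(4Dt)) − e^{γ(γt + x)/D} · erfc((2γt + x)/√(4Dt)) for t > 0. Then u(x, t) ∼ (2γ/x) √(4D/(π x²)) · t^{3/2} · e^{−x²/(4Dt)} as t → 0+. -/
open MeasureTheory Filter Set Real
open scoped Topology

/-- The complementary error function `erfc z = (2/√π) ∫_z^∞ e^{-u²} du`. -/
noncomputable def erfc (z : ℝ) : ℝ :=
  (2 / Real.sqrt Real.pi) * ∫ u in Set.Ioi z, Real.exp (-u ^ 2)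

theorem gauss_tail_subst (s a : ℝ) (hs : 0 < s) :
    ∫ u in Set.Ioi (a / s), Real.exp (-u ^ 2) =
      s * Real.exp (-(a ^ 2 / s ^ 2)) *
        ∫ y in Set.Ioi (0 : ℝ), Real.exp (-(s ^ 2 * y ^ 2) - 2 * a * y) := by
  have h1 := (measurePreserving_add_right (volume : Measure ℝ) (a / s)).setIntegral_preimage_emb
    (measurableEmbedding_addRight (a / s)) (fun u => Real.exp (-u ^ 2)) (Set.Ioi (a / s))
  have h2 := integral_comp_mul_left_Ioi (fun u => Real.exp (-(u + a / s) ^ 2)) 0 hs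
  have h3 : (fun x : ℝ => x + a / s) ⁻¹' (Set.Ioi (a / s)) = Set.Ioi 0 := by
    ext y; simp
  rw [h3] at h1
  rw [← h1]
  rw [mul_zero, smul_eq_mul] at h2
  have h4 : ∀ y : ℝ, Real.exp (-(s * y + a / s) ^ 2) =
      Real.exp (-(a ^ 2 / s ^ 2)) * Real.exp (-(s ^ 2 * y ^ 2) - 2 * a * y) := by
    intro y
    rw [← Real.exp_add]
    congr 1
    field_simp
    ring
  simp_rw [h4] at h2
  rw [integral_const_mul] at h2
  rw [mul_assoc, h2, mul_inv_cancel_left₀ hs.ne']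

theorem gauss_lin_integrable (b a : ℝ) (hb : 0 < b) :
    IntegrableOn (fun y : ℝ => Real.exp (-(b * y ^ 2) - 2 * a * y)) (Set.Ioi 0) := by
  have h := ((integrable_exp_neg_mul_sq hb).comp_add_right (a / b)).const_mul
    (Real.exp (a ^ 2 / b))
  refine Integrable.integrableOn (h.congr (Eventually.of_forall fun y => ?_))
  simp only
  rw [← Real.exp_add]
  congr 1
  field_simp
  ring

theorem lin_exp_integral (x : ℝ) (hx : 0 < x) :
    IntegrableOn (fun y : ℝ => y * Real.exp (-(2 * x * y))) (Set.Ioi 0) ∧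
    ∫ y in Set.Ioi (0 : ℝ), y * Real.exp (-(2 * x * y)) = 1 / (4 * x ^ 2) := by
  constructor
  · have h := integrableOn_rpow_mul_exp_neg_mul_rpow (p := 1) (s := 1) (b := 2 * x)
      (by norm_num) (by norm_num) (by positivity)
    simpa using h
  · have h := Real.integral_rpow_mul_exp_neg_mul_Ioi (a := 2) (r := 2 * x)
      (by norm_num) (by positivity)
    have h5 : ((2 : ℝ) - 1) = 1 := by norm_num
    simp only [h5, Real.rpow_one] at h
    rw [h, Real.Gamma_two, Real.rpow_two]
    field_simp
    norm_num

theorem key_limit (D γ x : ℝ) (hD : 0 < D) (hγ : 0 < γ) (hx : 0 < x) :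
    Tendsto (fun t : ℝ => ∫ y in Set.Ioi (0 : ℝ),
      Real.exp (-(4 * D * t * y ^ 2)) * Real.exp (-(2 * x * y)) *
        ((1 - Real.exp (-(4 * γ * t * y))) / t)) (𝓝[>] 0) (𝓝 (γ / x ^ 2)) := by
  obtain ⟨hi, he⟩ := lin_exp_integral x hx
  have hval : γ / x ^ 2 = ∫ y in Set.Ioi (0 : ℝ), 4 * γ * (y * Real.exp (-(2 * x * y))) := by
    rw [integral_const_mul, he]; field_simp
  rw [hval]
  apply tendsto_integral_filter_of_dominated_convergence
    (fun y => 4 * γ * (y * Real.exp (-(2 * x * y))))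
  · refine Eventually.of_forall fun t => ?_
    exact (by fun_prop : Continuous fun y : ℝ =>
      Real.exp (-(4 * D * t * y ^ 2)) * Real.exp (-(2 * x * y)) *
        ((1 - Real.exp (-(4 * γ * t * y))) / t)).aestronglyMeasurable
  · filter_upwards [self_mem_nhdsWithin] with t ht
    have ht : 0 < t := ht
    filter_upwards [ae_restrict_mem measurableSet_Ioi] with y hy
    have hy : 0 < y := hy
    have e1 : Real.exp (-(4 * D * t * y ^ 2)) ≤ 1 := Real.exp_le_one_iff.2 (by
      have : 0 < 4 * D * t * y ^ 2 := by positivity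
      linarith)
    have e2 : Real.exp (-(4 * γ * t * y)) ≤ 1 := Real.exp_le_one_iff.2 (by
      have : 0 < 4 * γ * t * y := by positivity
      linarith)
    have e3 := Real.add_one_le_exp (-(4 * γ * t * y))
    have e4 : (1 - Real.exp (-(4 * γ * t * y))) / t ≤ 4 * γ * y := by
      rw [div_le_iff₀ ht]; nlinarith
    have e5 : 0 ≤ (1 - Real.exp (-(4 * γ * t * y))) / t :=
      div_nonneg (by linarith) ht.le
    rw [Real.norm_of_nonneg (by positivity)]
    calc _ ≤ 1 * Real.exp (-(2 * x * y)) * (4 * γ * y) := by gcongr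
      _ = _ := by ring
  · exact hi.const_mul _
  · refine Eventually.of_forall fun y => ?_
    have d : HasDerivAt (fun t : ℝ => 1 - Real.exp (-(4 * γ * t * y))) (4 * γ * y) 0 := by
      have h1 : HasDerivAt (fun t : ℝ => -(4 * γ * t * y)) (-(4 * γ * y)) 0 := by
        have := (((hasDerivAt_id (0 : ℝ)).const_mul (4 * γ)).mul_const y).neg
        simpa using! this
      have := (h1.exp).const_sub 1
      simpa using this
    have d2 := d.tendsto_slope_zero_right
    have c : Tendsto (fun t : ℝ => Real.exp (-(4 * D * t * y ^ 2)) * Real.exp (-(2 * x * y)))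
        (𝓝[>] 0) (𝓝 (Real.exp (-(2 * x * y)))) := by
      have hc : Continuous fun t : ℝ =>
        Real.exp (-(4 * D * t * y ^ 2)) * Real.exp (-(2 * x * y)) := by fun_prop
      have := (hc.tendsto 0).mono_left (nhdsWithin_le_nhds (s := Set.Ioi 0))
      simpa using this
    have := c.mul d2
    convert this using 2
    · simp [div_eq_inv_mul]
    · ring

/-- **Short-time asymptotics of the absorption probability at a partially absorbing
boundary.**  For `D > 0`, `γ > 0`, `x > 0` and
`u(x,t) = erfc(x/√(4Dt)) − e^{γ(γt+x)/D} erfc((2γt+x)/√(4Dt))`, one has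
`u(x,t) ∼ (2γ/x) √(4D/(π x²)) t^{3/2} e^{-x²/(4Dt)}` as `t → 0+`. -/
theorem partially_absorbing_short_time_asymptotics
    (D γ x : ℝ) (hD : 0 < D) (hγ : 0 < γ) (hx : 0 < x)
    (u : ℝ → ℝ)
    (hu : ∀ t : ℝ, u t = erfc (x / Real.sqrt (4 * D * t)) -
        Real.exp (γ * (γ * t + x) / D) * erfc ((2 * γ * t + x) / Real.sqrt (4 * D * t))) :
    Tendsto
      (fun t : ℝ =>
        u t / (2 * γ / x * Real.sqrt (4 * D / (Real.pi * x ^ 2)) * t ^ ((3 : ℝ) / 2) *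
          Real.exp (-(x ^ 2) / (4 * D * t))))
      (𝓝[>] 0) (𝓝 1) := by
  have hk := (key_limit D γ x hD hγ hx).const_mul (x ^ 2 / γ)
  rw [show x ^ 2 / γ * (γ / x ^ 2) = 1 by field_simp] at hk
  refine hk.congr' ?_
  filter_upwards [self_mem_nhdsWithin] with t ht
  have ht : 0 < t := ht
  have hs : 0 < Real.sqrt (4 * D * t) := Real.sqrt_pos.2 (by positivity)
  have hs2 : Real.sqrt (4 * D * t) ^ 2 = 4 * D * t := Real.sq_sqrt (by positivity)
  have hb : 0 < 4 * D * t := by positivity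
  have hden : 2 * γ / x * Real.sqrt (4 * D / (Real.pi * x ^ 2)) * t ^ ((3 : ℝ) / 2) =
      2 * γ / x ^ 2 / Real.sqrt Real.pi * t * Real.sqrt (4 * D * t) := by
    have h32 : t ^ ((3 : ℝ) / 2) = t * Real.sqrt t := by
      rw [show (3 : ℝ) / 2 = 1 + 1 / 2 by norm_num, Real.rpow_add ht, Real.rpow_one,
        ← Real.sqrt_eq_rpow]
    rw [h32, Real.sqrt_div (by positivity), Real.sqrt_mul Real.pi_pos.le, Real.sqrt_sq hx.le,
      Real.sqrt_mul (by positivity : (0 : ℝ) ≤ 4 * D) t]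
    field_simp
  have hF : ∫ y in Set.Ioi (0 : ℝ), Real.exp (-(4 * D * t * y ^ 2)) * Real.exp (-(2 * x * y)) *
        ((1 - Real.exp (-(4 * γ * t * y))) / t) =
      ((∫ y in Set.Ioi (0 : ℝ), Real.exp (-(4 * D * t * y ^ 2) - 2 * x * y)) -
       ∫ y in Set.Ioi (0 : ℝ), Real.exp (-(4 * D * t * y ^ 2) - 2 * (2 * γ * t + x) * y)) / t := by
    rw [← integral_sub (gauss_lin_integrable _ _ hb) (gauss_lin_integrable _ _ hb),
      ← integral_div]
    congr 1
    ext y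
    rw [mul_div_assoc', mul_sub, mul_one, ← Real.exp_add, ← Real.exp_add]
    congr 3
    ring
  have hexp : Real.exp (γ * (γ * t + x) / D) * Real.exp (-((2 * γ * t + x) ^ 2 / (4 * D * t))) =
      Real.exp (-(x ^ 2) / (4 * D * t)) := by
    rw [← Real.exp_add]
    congr 1
    field_simp
    ring
  have hexp2 : Real.exp (-(x ^ 2 / (4 * D * t))) = Real.exp (-(x ^ 2) / (4 * D * t)) := by
    rw [neg_div]
  rw [hu, erfc, erfc, gauss_tail_subst _ _ hs, gauss_tail_subst _ _ hs, hden, hF, hs2, hexp2]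
  generalize (∫ y in Set.Ioi (0 : ℝ), Real.exp (-(4 * D * t * y ^ 2) - 2 * x * y)) = A
  generalize (∫ y in Set.Ioi (0 : ℝ),
    Real.exp (-(4 * D * t * y ^ 2) - 2 * (2 * γ * t + x) * y)) = B
  have hp : 0 < Real.sqrt Real.pi := Real.sqrt_pos.2 Real.pi_pos
  have hE : 0 < Real.exp (-(x ^ 2) / (4 * D * t)) := Real.exp_pos _
  rw [show ∀ p q r S B : ℝ, p * (q * (S * r * B)) = q * S * (p * r) * B from
    fun p q r S B => by ring, hexp]
  generalize Real.exp (-(x ^ 2) / (4 * D * t)) = E at *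
  generalize Real.sqrt (4 * D * t) = S at *
  field_simp
end
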